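/- arXiv:2511.00302 — 3 statements merged into one kernel-verified Lean document; each statement's English description precedes it below -/
import Mathlib

section
/- There is an absolute constant C > 0 such that for all Schwartz functions φ, ψ : ℝ → ℂ the following bilinear Strichartz estimate for the free Schrödinger flow holds. Define u(t,x) = (2π)^{-1/2} ∫_ℝ φ̂(ξ) e^{i(xξ + tξ²)} dξ and v(t,x) = (2π)^{-1/2} ∫_ℝ ψ̂(ξ) e^{i(xξ + tξ²)} dξ (these solve ∂_t w + i ∂_x² w = 0 with data φ and ψ). Then ∫_ℝ ∫_ℝ |ξ| · | (2π)^{-1/2} ∫_ℝ u(t,x) · conj(v(t,x)) e^{-ixξ} dx |² dξ dt ≤ C ‖φ‖_{L²(ℝ)}² ‖ψ‖_{L²(ℝ)}². Equivalently, ‖ |∂_x|^{1/2}( e^{-it∂_x²}φ · conj(e^{-it∂_x²}ψ) ) ‖_{L²_{t,x}(ℝ×ℝ)} ≲ ‖φ‖_{L²} ‖ψ‖_{L²}. -/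
open MeasureTheory Complex

/-- The Fourier transform, normalized as `ĝ(ξ) = (2π)^{-1/2} ∫ g(y) e^{-iyξ} dy`. -/
noncomputable def FT (f : ℝ → ℂ) (ξ : ℝ) : ℂ :=
  (Real.sqrt (2 * Real.pi))⁻¹ • ∫ x : ℝ, f x * Complex.exp (-(Complex.I * x * ξ))

/-- The free Schrödinger flow `u(t,x) = (2π)^{-1/2} ∫ φ̂(ξ) e^{i(xξ + tξ²)} dξ`,
solving `∂_t u + i ∂_x² u = 0` with data `φ`. -/
noncomputable def schrodingerFlow (φ : ℝ → ℂ) (t x : ℝ) : ℂ :=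
  (Real.sqrt (2 * Real.pi))⁻¹ • ∫ ξ : ℝ, FT φ ξ * Complex.exp (Complex.I * (x * ξ + t * ξ ^ 2))

open scoped FourierTransform in
lemma FT_eq (f : ℝ → ℂ) (ξ : ℝ) :
    FT f ξ = (Real.sqrt (2 * Real.pi))⁻¹ • (𝓕 f) (ξ / (2 * Real.pi)) := by
  rw [FT, Real.fourier_real_eq_integral_exp_smul]
  congr 1
  apply integral_congr_ae
  filter_upwards with x
  rw [smul_eq_mul, mul_comm]
  congr 2
  have : (Real.pi : ℂ) ≠ 0 := by exact_mod_cast Real.pi_ne_zero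
  push_cast
  field_simp

lemma c_sq : (Real.sqrt (2 * Real.pi))⁻¹ * (Real.sqrt (2 * Real.pi))⁻¹ = (2 * Real.pi)⁻¹ := by
  rw [← mul_inv, Real.mul_self_sqrt (by positivity)]

/-- The modulated frequency profile. -/
noncomputable def prof (P : ℝ → ℂ) (t s : ℝ) : ℂ :=
  P s * Complex.exp (((4 * Real.pi ^ 2 * t * s ^ 2 : ℝ) : ℂ) * Complex.I)

lemma norm_prof (P : ℝ → ℂ) (t s : ℝ) : ‖prof P t s‖ = ‖P s‖ := by
  rw [prof, norm_mul, Complex.norm_exp_ofReal_mul_I, mul_one]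

open scoped FourierTransform in
lemma flow_eq_integral (φ : ℝ → ℂ) (t x : ℝ) :
    schrodingerFlow φ t x
      = ∫ s : ℝ, prof (𝓕 φ) t s * Complex.exp (((2 * Real.pi * x * s : ℝ) : ℂ) * Complex.I) := by
  have h := Measure.integral_comp_div (fun s : ℝ => prof (𝓕 φ) t s *
    Complex.exp (((2 * Real.pi * x * s : ℝ) : ℂ) * Complex.I)) (2 * Real.pi)
  have h2 : ∀ ξ : ℝ, FT φ ξ * Complex.exp (Complex.I * (x * ξ + t * ξ ^ 2))
     = (Real.sqrt (2 * Real.pi))⁻¹ • (prof (𝓕 φ) t (ξ / (2 * Real.pi)) *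
    Complex.exp (((2 * Real.pi * x * (ξ / (2 * Real.pi)) : ℝ) : ℂ) * Complex.I)) := by
    intro ξ
    rw [FT_eq, prof, smul_mul_assoc, mul_assoc, ← Complex.exp_add]
    congr 3
    have : (Real.pi : ℂ) ≠ 0 := by exact_mod_cast Real.pi_ne_zero
    push_cast
    field_simp
    ring
  rw [schrodingerFlow]
  simp_rw [h2]
  rw [integral_smul, h, smul_smul, smul_smul, c_sq, abs_of_pos (by positivity),
    inv_mul_cancel₀ (by positivity), one_smul]

open scoped FourierTransform in
lemma flow_eq (φ : ℝ → ℂ) (t x : ℝ) :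
    schrodingerFlow φ t x = 𝓕 (fun s => prof (𝓕 φ) t (-s)) x := by
  rw [flow_eq_integral, Real.fourier_real_eq_integral_exp_smul, ← integral_neg_eq_self]
  congr 1
  ext s
  rw [smul_eq_mul, mul_comm]
  congr 3
  push_cast; ring

open scoped FourierTransform in
lemma conj_flow_eq (φ : ℝ → ℂ) (t x : ℝ) :
    (starRingEnd ℂ) (schrodingerFlow φ t x)
      = 𝓕 (fun s => (starRingEnd ℂ) (prof (𝓕 φ) t s)) x := by
  rw [flow_eq_integral, Real.fourier_real_eq_integral_exp_smul, ← integral_conj]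
  congr 1
  ext s
  rw [smul_eq_mul, mul_comm, map_mul, ← Complex.exp_conj]
  congr 2
  simp only [map_mul, Complex.conj_I, Complex.conj_ofReal]
  push_cast; ring

/-- The product whose Fourier transform gives the time-dependence. -/
noncomputable def kern (P Q : ℝ → ℂ) (t ξ : ℝ) : ℂ :=
  ∫ r : ℝ, Complex.exp (((-2 * Real.pi * r * (-2 * ξ * t) : ℝ) : ℂ) * Complex.I) *
    (P r * (starRingEnd ℂ) (Q (r - ξ / (2 * Real.pi))))

open scoped Convolution in
lemma conv_eq (P Q : ℝ → ℂ) (t ξ : ℝ) :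
    ‖((fun s => prof P t (-s)) ⋆[ContinuousLinearMap.mul ℂ ℂ]
      (fun s => (starRingEnd ℂ) (prof Q t s))) (-(ξ / (2 * Real.pi)))‖ = ‖kern P Q t ξ‖ := by
  rw [convolution_def, ← integral_neg_eq_self]
  have : ∀ r : ℝ, ContinuousLinearMap.mul ℂ ℂ (prof P t (- -r))
      ((starRingEnd ℂ) (prof Q t (-(ξ / (2 * Real.pi)) - -r)))
      = Complex.exp (((- t * ξ ^ 2 : ℝ) : ℂ) * Complex.I) *
       (Complex.exp (((-2 * Real.pi * r * (-2 * ξ * t) : ℝ) : ℂ) * Complex.I) *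
    (P r * (starRingEnd ℂ) (Q (r - ξ / (2 * Real.pi))))) := by
    intro r
    rw [ContinuousLinearMap.mul_apply', prof, prof, neg_neg, map_mul, ← Complex.exp_conj,
      show -(ξ / (2 * Real.pi)) - -r = r - ξ / (2 * Real.pi) by ring]
    have e : Complex.exp (((4 * Real.pi ^ 2 * t * r ^ 2 : ℝ) : ℂ) * Complex.I) *
      Complex.exp ((starRingEnd ℂ) (((4 * Real.pi ^ 2 * t * (r - ξ / (2 * Real.pi)) ^ 2 : ℝ) : ℂ)
        * Complex.I)) = Complex.exp (((- t * ξ ^ 2 : ℝ) : ℂ) * Complex.I) *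
       Complex.exp (((-2 * Real.pi * r * (-2 * ξ * t) : ℝ) : ℂ) * Complex.I) := by
      rw [← Complex.exp_add, ← Complex.exp_add]
      congr 1
      simp only [map_mul, Complex.conj_I, Complex.conj_ofReal]
      have : (Real.pi : ℂ) ≠ 0 := by exact_mod_cast Real.pi_ne_zero
      push_cast
      field_simp
      ring
    rw [← mul_assoc (Complex.exp _), ← e]
    ring
  simp_rw [this]
  rw [integral_const_mul, norm_mul, Complex.norm_exp_ofReal_mul_I, one_mul, kern]

lemma continuous_prof {P : ℝ → ℂ} (hP : Continuous P) (t : ℝ) : Continuous (prof P t) := by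
  unfold prof; fun_prop

open scoped FourierTransform Convolution in
lemma key1 (φ ψ : SchwartzMap ℝ ℂ) (t ξ : ℝ) :
    ‖FT (fun x => schrodingerFlow (⇑φ) t x *
            (starRingEnd ℂ) (schrodingerFlow (⇑ψ) t x)) ξ‖ ≤
    (Real.sqrt (2 * Real.pi))⁻¹ * ‖kern (𝓕 φ : SchwartzMap ℝ ℂ) (𝓕 ψ : SchwartzMap ℝ ℂ) t ξ‖ := by
  have hP : Integrable (fun s => prof (𝓕 φ : SchwartzMap ℝ ℂ) t (-s)) := by
    apply Integrable.comp_neg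
    refine (𝓕 φ).integrable.mono (continuous_prof (𝓕 φ).continuous t).aestronglyMeasurable ?_
    filter_upwards with s using (norm_prof _ _ _).le
  have hQ : Integrable (fun s => (starRingEnd ℂ) (prof (𝓕 ψ : SchwartzMap ℝ ℂ) t s)) := by
    refine (𝓕 ψ).integrable.mono (Complex.continuous_conj.comp
      (continuous_prof (𝓕 ψ).continuous t)).aestronglyMeasurable ?_
    filter_upwards with s
    rw [RCLike.norm_conj, norm_prof]
  set h := (fun s => prof (𝓕 φ : SchwartzMap ℝ ℂ) t (-s)) ⋆[ContinuousLinearMap.mul ℂ ℂ]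
      (fun s => (starRingEnd ℂ) (prof (𝓕 ψ : SchwartzMap ℝ ℂ) t s)) with hh
  have hprod : (fun x => schrodingerFlow (⇑φ) t x *
            (starRingEnd ℂ) (schrodingerFlow (⇑ψ) t x)) = 𝓕 h := by
    ext x
    rw [hh, Real.fourier_mul_convolution_eq hP hQ, flow_eq, conj_flow_eq, SchwartzMap.fourier_coe,
      SchwartzMap.fourier_coe]
  have hcont : Continuous h := by
    refine BddAbove.continuous_convolution_right_of_integrable _ ?_ hP
      (Complex.continuous_conj.comp (continuous_prof (𝓕 ψ).continuous t))
    refine ⟨‖(𝓕 ψ).toBoundedContinuousFunction‖, ?_⟩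
    rintro _ ⟨s, rfl⟩
    simp only
    rw [RCLike.norm_conj, norm_prof]
    exact (𝓕 ψ).toBoundedContinuousFunction.norm_coe_le_norm s
  have hint : Integrable h := hP.integrable_convolution _ hQ
  rw [hprod, FT_eq, norm_smul, norm_inv, Real.norm_of_nonneg (Real.sqrt_nonneg _)]
  gcongr
  by_cases hi : Integrable (𝓕 h)
  · have := congrFun (hcont.fourierInv_fourier_eq hint hi) (-(ξ / (2 * Real.pi)))
    rw [Real.fourierInv_eq_fourier_neg, neg_neg] at this
    rw [this, hh, conv_eq]
  · have : 𝓕 (𝓕 h) (ξ / (2 * Real.pi)) = 0 := by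
      rw [Real.fourier_eq]
      apply integral_undef
      rwa [Real.fourierIntegral_convergent_iff]
    rw [this, norm_zero]
    positivity

/-- conj as a Schwartz map operation -/
noncomputable def conjS (f : SchwartzMap ℝ ℂ) : SchwartzMap ℝ ℂ :=
  SchwartzMap.postcompCLM (𝕜 := ℝ) (Complex.conjCLE : ℂ →L[ℝ] ℂ) f

noncomputable def GS (P Q : SchwartzMap ℝ ℂ) (σ : ℝ) : SchwartzMap ℝ ℂ :=
  SchwartzMap.pairing (ContinuousLinearMap.mul ℂ ℂ) P
    (conjS (SchwartzMap.compSubConstCLM ℂ σ Q))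

lemma GS_apply (P Q : SchwartzMap ℝ ℂ) (σ r : ℝ) :
    GS P Q σ r = P r * (starRingEnd ℂ) (Q (r - σ)) := by
  simp [GS, conjS]

open scoped FourierTransform in
lemma kern_eq (P Q : SchwartzMap ℝ ℂ) (t ξ : ℝ) :
    kern P Q t ξ = 𝓕 (GS P Q (ξ / (2 * Real.pi))) (-2 * ξ * t) := by
  rw [SchwartzMap.fourier_coe, Real.fourier_real_eq_integral_exp_smul, kern]
  simp only [GS_apply, smul_eq_mul]

lemma integrable_sq (f : SchwartzMap ℝ ℂ) : Integrable (fun x => ‖f x‖ ^ 2) :=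
  (memLp_two_iff_integrable_sq_norm f.continuous.aestronglyMeasurable).1 (f.memLp 2)

open scoped FourierTransform in
lemma lint_t (P Q : SchwartzMap ℝ ℂ) (ξ : ℝ) (hξ : ξ ≠ 0) :
    ∫⁻ t : ℝ, ENNReal.ofReal (|ξ| * ((2 * Real.pi)⁻¹ * ‖kern P Q t ξ‖ ^ 2))
      = ENNReal.ofReal ((4 * Real.pi)⁻¹ * ∫ r : ℝ, ‖P r‖ ^ 2 * ‖Q (r - ξ / (2 * Real.pi))‖ ^ 2)
      := by
  have hI := (integrable_sq (𝓕 (GS P Q (ξ / (2 * Real.pi))))).comp_mul_left' (R := -2 * ξ)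
    (by simpa using hξ)
  simp_rw [kern_eq]
  rw [← ofReal_integral_eq_lintegral_ofReal ((hI.const_mul _).const_mul _)
    (Filter.Eventually.of_forall fun t => by positivity)]
  congr 1
  rw [integral_const_mul, integral_const_mul]
  rw [Measure.integral_comp_mul_left (fun y => ‖𝓕 (GS P Q (ξ / (2 * Real.pi))) y‖ ^ 2) (-2 * ξ),
    SchwartzMap.integral_norm_sq_fourier]
  simp only [GS_apply, norm_mul, RCLike.norm_conj, mul_pow, smul_eq_mul, abs_inv, abs_mul]
  have : |ξ| ≠ 0 := abs_ne_zero.2 hξ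
  norm_num
  field_simp
  ring

lemma measurable_kern (P Q : SchwartzMap ℝ ℂ) :
    StronglyMeasurable (fun p : ℝ × ℝ => kern P Q p.1 p.2) := by
  unfold kern
  apply StronglyMeasurable.integral_prod_right (f := fun (p : ℝ × ℝ) (r : ℝ) =>
    Complex.exp (((-2 * Real.pi * r * (-2 * p.2 * p.1) : ℝ) : ℂ) * Complex.I) *
    (P r * (starRingEnd ℂ) (Q (r - p.2 / (2 * Real.pi)))))
  apply Continuous.stronglyMeasurable
  have := P.continuous
  have := Q.continuous
  have := Complex.continuous_conj
  unfold Function.uncurry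
  fun_prop

open scoped Convolution in
lemma lint_xi (P Q : SchwartzMap ℝ ℂ) :
    ∫⁻ ξ : ℝ, ENNReal.ofReal ((4 * Real.pi)⁻¹ *
      ∫ r : ℝ, ‖P r‖ ^ 2 * ‖Q (r - ξ / (2 * Real.pi))‖ ^ 2)
    = ENNReal.ofReal (2⁻¹ * (∫ r, ‖P r‖ ^ 2) * ∫ r, ‖Q r‖ ^ 2) := by
  have hP := integrable_sq P
  have hQ : Integrable (fun x => ‖Q (-x)‖ ^ 2) := (integrable_sq Q).comp_neg
  have hc := hP.integrable_convolution (ContinuousLinearMap.mul ℝ ℝ) hQ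
  have hi := integral_convolution (μ := volume) (ν := volume) (ContinuousLinearMap.mul ℝ ℝ) hP hQ
  have heq : ∀ ξ : ℝ, ∫ r : ℝ, ‖P r‖ ^ 2 * ‖Q (r - ξ / (2 * Real.pi))‖ ^ 2
    = ((fun x => ‖P x‖ ^ 2) ⋆[ContinuousLinearMap.mul ℝ ℝ] (fun x => ‖Q (-x)‖ ^ 2))
      (ξ / (2 * Real.pi)) := by
    intro ξ
    rw [convolution_def]
    simp
  simp_rw [heq]
  rw [← ofReal_integral_eq_lintegral_ofReal ((hc.comp_div (by positivity)).const_mul _)]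
  · congr 1
    rw [integral_const_mul, Measure.integral_comp_div, hi, integral_neg_eq_self (fun x => ‖Q x‖ ^ 2),
      abs_of_pos (by positivity)]
    simp only [ContinuousLinearMap.mul_apply', smul_eq_mul]
    field_simp
    ring
  · refine Filter.Eventually.of_forall fun ξ => ?_
    simp only [← heq]
    have : 0 ≤ ∫ r : ℝ, ‖P r‖ ^ 2 * ‖Q (r - ξ / (2 * Real.pi))‖ ^ 2 :=
      integral_nonneg fun r => by positivity
    simp only [Pi.zero_apply]
    positivity

/-- Bilinear Strichartz estimate:
`‖ |∂_x|^{1/2}( e^{-it∂_x²}φ · conj(e^{-it∂_x²}ψ) ) ‖_{L²_{t,x}} ≲ ‖φ‖_{L²} ‖ψ‖_{L²}`. -/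
theorem bilinear_strichartz :
    ∃ C : ℝ, 0 < C ∧ ∀ φ ψ : SchwartzMap ℝ ℂ,
      (∫ t : ℝ, ∫ ξ : ℝ,
          |ξ| * ‖FT (fun x => schrodingerFlow (⇑φ) t x *
            (starRingEnd ℂ) (schrodingerFlow (⇑ψ) t x)) ξ‖ ^ 2)
        ≤ C * (∫ x : ℝ, ‖φ x‖ ^ 2) * (∫ x : ℝ, ‖ψ x‖ ^ 2) := by
  refine ⟨2⁻¹, by norm_num, fun φ ψ => ?_⟩
  open scoped FourierTransform in
  rw [← SchwartzMap.integral_norm_sq_fourier φ, ← SchwartzMap.integral_norm_sq_fourier ψ]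
  set P := FourierTransform.fourier φ with hP
  set Q := FourierTransform.fourier ψ with hQ
  have hR : 0 ≤ 2⁻¹ * (∫ r, ‖P r‖ ^ 2) * ∫ r, ‖Q r‖ ^ 2 := by positivity
  rw [← ENNReal.ofReal_le_ofReal_iff hR]
  refine (Real.ofReal_le_enorm _).trans ?_
  refine (enorm_integral_le_lintegral_enorm _).trans ?_
  calc _ ≤ ∫⁻ t : ℝ, ∫⁻ ξ : ℝ,
          ENNReal.ofReal (|ξ| * ((2 * Real.pi)⁻¹ * ‖kern P Q t ξ‖ ^ 2)) := by
        refine lintegral_mono fun t => (enorm_integral_le_lintegral_enorm _).trans ?_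
        refine lintegral_mono fun ξ => ?_
        rw [Real.enorm_of_nonneg (by positivity)]
        apply ENNReal.ofReal_le_ofReal
        gcongr
        rw [← c_sq, ← pow_two, ← mul_pow]
        gcongr
        exact key1 φ ψ t ξ
    _ = ∫⁻ ξ : ℝ, ∫⁻ t : ℝ,
          ENNReal.ofReal (|ξ| * ((2 * Real.pi)⁻¹ * ‖kern P Q t ξ‖ ^ 2)) := by
        apply lintegral_lintegral_swap
        have := (measurable_kern P Q).norm.measurable
        apply Measurable.aemeasurable
        unfold Function.uncurry
        fun_prop
    _ = ∫⁻ ξ : ℝ, ENNReal.ofReal ((4 * Real.pi)⁻¹ *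
          ∫ r : ℝ, ‖P r‖ ^ 2 * ‖Q (r - ξ / (2 * Real.pi))‖ ^ 2) := by
        apply lintegral_congr_ae
        filter_upwards [Measure.ae_ne volume (0 : ℝ)] with ξ hξ
        exact lint_t P Q ξ hξ
    _ = _ := lint_xi P Q
end

section
/- Cotlar-type identity for the Tilbert transform. Let 0 < h < ∞ and let f, g : ℝ → ℂ be Schwartz functions. Suppose F₁, F₂, F₃ : ℝ → ℂ are bounded measurable functions such that for every x ∈ ℝ, as ε → 0⁺: (1/(2h)) ∫_{|x-y|>ε} coth(π(x-y)/(2h)) f(y) dy → F₁(x), (1/(2h)) ∫_{|x-y|>ε} coth(π(x-y)/(2h)) g(y) dy → F₂(x), and (1/(2h)) ∫_{|x-y|>ε} coth(π(x-y)/(2h)) (f(y)F₂(y) + g(y)F₁(y)) dy → F₃(x) (i.e. F₁ = 𝒯_h f, F₂ = 𝒯_h g, F₃ = 𝒯_h(f·𝒯_h g + g·𝒯_h f) as principal values). Then for every x ∈ ℝ, F₃(x) = F₁(x)·F₂(x) − f(x)·g(x) − M_f·M_g, where M_f = (1/(2h)) ∫_ℝ f(y) dy and M_g = (1/(2h)) ∫_ℝ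 g(y) dy. -/
open MeasureTheory Complex Filter

/-- The real hyperbolic cotangent. -/
noncomputable def coth (x : ℝ) : ℝ := Real.cosh x / Real.sinh x

/-- The ε-truncated Tilbert transform
`(1/(2h)) ∫_{|x-y|>ε} coth(π(x-y)/(2h)) f(y) dy`. -/
noncomputable def truncTilbert (h : ℝ) (f : ℝ → ℂ) (x ε : ℝ) : ℂ :=
  (2 * h)⁻¹ • ∫ y in {y : ℝ | ε < |x - y|},
    (coth (Real.pi * (x - y) / (2 * h)) : ℂ) * f y

/-- complex hyperbolic cotangent -/
noncomputable def Cc (z : ℂ) : ℂ := Complex.cosh z / Complex.sinh z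

lemma coth_eq_Cc (x : ℝ) : ((coth x : ℝ) : ℂ) = Cc x := by
  simp [coth, Cc]

lemma coth_neg' (x : ℝ) : coth (-x) = - coth x := by
  simp [coth, div_neg]

lemma abs_le_abs_sinh (s : ℝ) : |s| ≤ |Real.sinh s| := by
  rcases le_total 0 s with h | h
  · rw [abs_of_nonneg h, abs_of_nonneg (Real.sinh_nonneg_iff.2 h)]
    exact Real.self_le_sinh_iff.2 h
  · rw [abs_of_nonpos h, abs_of_nonpos (Real.sinh_nonpos_iff.2 h)]
    linarith [Real.sinh_le_self_iff.2 h]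

lemma abs_coth_le (s : ℝ) : |coth s| ≤ 1 + 1 / |s| := by
  by_cases hs : s = 0
  · simp [hs, coth]
  have h0 : 0 < |s| := abs_pos.2 hs
  have h1 := abs_le_abs_sinh s
  have h2 : 0 < |Real.sinh s| := h0.trans_le h1
  have h3 : Real.cosh s ≤ |Real.sinh s| + 1 := by
    refine le_of_pow_le_pow_left₀ two_ne_zero (by positivity) ?_
    have := Real.cosh_sq s
    nlinarith [sq_abs (Real.sinh s)]
  rw [coth, abs_div, abs_of_pos (Real.cosh_pos s)]
  calc Real.cosh s / |Real.sinh s| ≤ (|Real.sinh s| + 1) / |Real.sinh s| := by gcongr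
    _ = 1 + 1 / |Real.sinh s| := by field_simp
    _ ≤ 1 + 1 / |s| := by gcongr

lemma normSq_sinh (s d : ℝ) : ‖Complex.sinh (s + d * I)‖ ^ 2 = Real.sinh s ^ 2 + Real.sin d ^ 2 := by
  rw [Complex.sinh_add, Complex.sinh_mul_I, Complex.cosh_mul_I, ← Complex.normSq_eq_norm_sq]
  rw [show Complex.sinh s * Complex.cos d + Complex.cosh s * (Complex.sin d * I)
    = ((Real.sinh s * Real.cos d : ℝ) : ℂ) + ((Real.cosh s * Real.sin d : ℝ) : ℂ) * I by
      push_cast; ring, Complex.normSq_add_mul_I]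
  nlinarith [Real.cosh_sq s, Real.sin_sq_add_cos_sq d]

lemma normSq_cosh (s d : ℝ) : ‖Complex.cosh (s + d * I)‖ ^ 2 = Real.sinh s ^ 2 + Real.cos d ^ 2 := by
  rw [Complex.cosh_add, Complex.sinh_mul_I, Complex.cosh_mul_I, ← Complex.normSq_eq_norm_sq]
  rw [show Complex.cosh s * Complex.cos d + Complex.sinh s * (Complex.sin d * I)
    = ((Real.cosh s * Real.cos d : ℝ) : ℂ) + ((Real.sinh s * Real.sin d : ℝ) : ℂ) * I by
      push_cast; ring, Complex.normSq_add_mul_I]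
  nlinarith [Real.cosh_sq s, Real.sin_sq_add_cos_sq d]

lemma sinh_lb1 (s d : ℝ) : |Real.sinh s| ≤ ‖Complex.sinh (s + d * I)‖ := by
  refine le_of_pow_le_pow_left₀ two_ne_zero (norm_nonneg _) ?_
  rw [normSq_sinh, sq_abs]; nlinarith [sq_nonneg (Real.sin d)]

lemma sinh_lb2 (s d : ℝ) : |Real.sin d| ≤ ‖Complex.sinh (s + d * I)‖ := by
  refine le_of_pow_le_pow_left₀ two_ne_zero (norm_nonneg _) ?_
  rw [normSq_sinh, sq_abs]; nlinarith [sq_nonneg (Real.sinh s)]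

lemma sin_lb {d : ℝ} (h0 : 0 < d) (h1 : d < 1) : d / 2 < Real.sin d := by
  have := Real.sin_gt_sub_cube h0
  nlinarith [mul_pos h0 h0, mul_pos (mul_pos h0 h0) (sub_pos.2 h1), mul_pos h0 (sub_pos.2 h1)]

lemma sinh_ne {d : ℝ} (h0 : 0 < d) (h1 : d < 1) (s : ℝ) : Complex.sinh (s + d * I) ≠ 0 := by
  have := sin_lb h0 h1
  rw [← norm_pos_iff]
  exact lt_of_lt_of_le (lt_of_lt_of_le (by linarith) (le_abs_self _)) (sinh_lb2 s d)

lemma Cc_bound {d : ℝ} (h0 : 0 < d) (h1 : d < 1) (s : ℝ) : ‖Cc (s + d * I)‖ ≤ 1 + 2 / d := by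
  have h2 := sin_lb h0 h1
  have h3 := sinh_lb2 s d
  rw [abs_of_pos (by linarith)] at h3
  have hN : 0 < ‖Complex.sinh (s + d * I)‖ := norm_pos_iff.2 (sinh_ne h0 h1 s)
  have h4 : ‖Complex.cosh (s + d * I)‖ ≤ ‖Complex.sinh (s + d * I)‖ + 1 := by
    refine le_of_pow_le_pow_left₀ two_ne_zero (by positivity) ?_
    have e1 := normSq_cosh s d
    have e2 := normSq_sinh s d
    nlinarith [Real.sin_sq_add_cos_sq d, sq_nonneg (Real.sin d)]
  rw [Cc, norm_div]
  calc _ ≤ (‖Complex.sinh (s + d * I)‖ + 1) / ‖Complex.sinh (s + d * I)‖ := by gcongr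
    _ = 1 + 1 / ‖Complex.sinh (s + d * I)‖ := by field_simp
    _ ≤ 1 + 1 / (d / 2) := by gcongr; linarith
    _ = 1 + 2 / d := by field_simp

lemma Cc_identity (P Q : ℂ) (hP : Complex.sinh P ≠ 0) (hQ : Complex.sinh Q ≠ 0)
    (hPQ : Complex.sinh (Q - P) ≠ 0) :
    Cc (Q - P) * (Cc P - Cc Q) = Cc P * Cc Q - 1 := by
  have e : Cc P - Cc Q = Complex.sinh (Q - P) / (Complex.sinh P * Complex.sinh Q) := by
    rw [Complex.sinh_sub]; unfold Cc; field_simp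
  have e2 : Cc P * Cc Q - 1 = Complex.cosh (Q - P) / (Complex.sinh P * Complex.sinh Q) := by
    rw [Complex.cosh_sub]; unfold Cc; field_simp
  rw [e, e2]; unfold Cc; field_simp

/-- rescaled kernel difference -/
noncomputable def EE (d s : ℝ) : ℂ :=
  d * (Cc (((d * s : ℝ) : ℂ) + d * I) - if 1 < |s| then ((coth (d * s) : ℝ) : ℂ) else 0)

lemma EE_bound {d : ℝ} (h0 : 0 < d) (h1 : d < 1) (s : ℝ) : ‖EE d s‖ ≤ 6 * (1 + s ^ 2)⁻¹ := by
  unfold EE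
  rw [norm_mul, Complex.norm_real, Real.norm_of_nonneg h0.le]
  split_ifs with hs
  · have hs2 : 1 < s ^ 2 := by rw [← sq_abs]; nlinarith
    have hs0 : s ≠ 0 := by rintro rfl; simp at hs; linarith
    have hds : 0 < |d * s| := abs_pos.2 (mul_ne_zero h0.ne' hs0)
    have k1 := abs_le_abs_sinh (d * s)
    have k2 := sinh_lb1 (d * s) d
    have n1 := sinh_ne h0 h1 (d * s)
    have n2 : Complex.sinh ((d * s : ℝ) : ℂ) ≠ 0 := by
      rw [← Complex.ofReal_sinh]
      exact_mod_cast (abs_pos.1 (hds.trans_le k1))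
    have e : Cc (((d * s : ℝ) : ℂ) + d * I) - ((coth (d * s) : ℝ) : ℂ)
        = - Complex.sinh (d * I) / (Complex.sinh (((d * s : ℝ) : ℂ) + d * I) * Complex.sinh ((d * s : ℝ) : ℂ)) := by
      rw [coth_eq_Cc]
      have : (d * I : ℂ) = (((d * s : ℝ) : ℂ) + d * I) - ((d * s : ℝ) : ℂ) := by ring
      rw [show Complex.sinh (d * I : ℂ) = Complex.sinh ((((d * s : ℝ) : ℂ) + d * I) - ((d * s : ℝ) : ℂ)) by congr 1, Complex.sinh_sub]
      unfold Cc; field_simp; ring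
    rw [e, norm_div, norm_neg, norm_mul, Complex.sinh_mul_I, norm_mul, Complex.norm_I, mul_one,
      ← Complex.ofReal_sin, Complex.norm_real, ← Complex.ofReal_sinh, Complex.norm_real,
      Real.norm_eq_abs, Real.norm_eq_abs]
    have hsin : |Real.sin d| ≤ d := by
      rw [abs_of_pos (by linarith [sin_lb h0 h1])]; exact (Real.sin_lt h0).le
    calc d * (|Real.sin d| / (‖Complex.sinh (((d * s : ℝ) : ℂ) + d * I)‖ * |Real.sinh (d * s)|))
        ≤ d * (d / (|d * s| * |d * s|)) := by gcongr; exact k1.trans k2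
      _ = (s ^ 2)⁻¹ := by
          rw [abs_mul_abs_self]; field_simp
      _ ≤ 6 * (1 + s ^ 2)⁻¹ := by
          rw [← div_eq_mul_inv, inv_eq_one_div, div_le_div_iff₀ (by positivity) (by positivity)]
          linarith
  · push Not at hs
    have hs2 : s ^ 2 ≤ 1 := by rw [← sq_abs]; nlinarith [abs_nonneg s]
    rw [sub_zero]
    calc _ ≤ d * (1 + 2 / d) := by gcongr; exact Cc_bound h0 h1 _
      _ = d + 2 := by field_simp
      _ ≤ 6 * (1 + s ^ 2)⁻¹ := by
        rw [← div_eq_mul_inv, le_div_iff₀ (by positivity)]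
        nlinarith [sq_nonneg s]

lemma tendsto_mul_Cc (w : ℂ) (hw : w ≠ 0) :
    Tendsto (fun d : ℝ => (d : ℂ) * Cc (d * w)) (nhdsWithin 0 (Set.Ioi 0)) (nhds (1 / w)) := by
  have hd : HasDerivAt (fun d : ℝ => Complex.sinh (d * w)) w 0 := by
    have : HasDerivAt (fun z : ℂ => Complex.sinh (z * w)) w ((0 : ℝ) : ℂ) := by
      have := ((hasDerivAt_id ((0 : ℝ) : ℂ)).mul_const w).csinh
      simpa using this
    exact this.comp_ofReal
  have hs := hd.tendsto_slope
  have h2 : Tendsto (fun d : ℝ => Complex.sinh (d * w) / d) (nhdsWithin 0 (Set.Ioi 0)) (nhds w) := by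
    refine (hs.mono_left (nhdsWithin_mono _ (fun x hx => ne_of_gt hx))).congr (fun d => ?_)
    simp [slope, div_eq_inv_mul]
  have h3 : Tendsto (fun d : ℝ => Complex.cosh (d * w)) (nhdsWithin 0 (Set.Ioi 0)) (nhds 1) := by
    have : Continuous (fun d : ℝ => Complex.cosh (d * w)) := by fun_prop
    have := this.tendsto 0
    simp only [Complex.ofReal_zero, zero_mul, Complex.cosh_zero] at this
    exact this.mono_left nhdsWithin_le_nhds
  refine (h3.div h2 hw).congr' ?_
  filter_upwards [self_mem_nhdsWithin] with d hd
  have : (d : ℂ) ≠ 0 := by exact_mod_cast (ne_of_gt hd)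
  simp only [Cc, Pi.div_apply]
  rw [div_div_eq_mul_div]; ring

/-- limit kernel -/
noncomputable def EL (s : ℝ) : ℂ := 1 / (s + I) - if 1 < |s| then 1 / (s : ℂ) else 0

lemma EE_tendsto (s : ℝ) :
    Tendsto (fun d => EE d s) (nhdsWithin 0 (Set.Ioi 0)) (nhds (EL s)) := by
  have hw : (s + I : ℂ) ≠ 0 := by
    intro h; have := congrArg Complex.im h; simp at this
  have t1 := tendsto_mul_Cc _ hw
  unfold EE EL
  split_ifs with hs
  · have hs0 : (s : ℂ) ≠ 0 := by
      have : s ≠ 0 := by rintro rfl; simp at hs; linarith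
      exact_mod_cast this
    refine (t1.sub (tendsto_mul_Cc _ hs0)).congr (fun d => ?_)
    rw [coth_eq_Cc]; push_cast; ring_nf
  · refine (t1.sub (tendsto_const_nhds (x := (0 : ℂ)))).congr (fun d => ?_)
    push_cast; ring_nf

lemma EL_bound (s : ℝ) : ‖EL s‖ ≤ 6 * (1 + s ^ 2)⁻¹ := by
  refine le_of_tendsto (EE_tendsto s).norm ?_
  filter_upwards [Ioo_mem_nhdsGT (zero_lt_one (α := ℝ))] with d hd
  exact EE_bound hd.1 hd.2 s

lemma coth_measurable : Measurable coth := by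
  unfold coth
  exact Real.measurable_cosh.div Real.measurable_sinh

lemma Cc_measurable : Measurable Cc := by
  unfold Cc
  exact Complex.measurable_cosh.div Complex.measurable_sinh

lemma EE_measurable (d : ℝ) : Measurable (EE d) := by
  unfold EE
  refine measurable_const.mul (Measurable.sub (Cc_measurable.comp (by fun_prop)) ?_)
  refine Measurable.ite (measurableSet_lt (by fun_prop) (by fun_prop)) ?_ measurable_const
  exact Complex.measurable_ofReal.comp (coth_measurable.comp (by fun_prop))

lemma EL_measurable : Measurable EL := by
  unfold EL
  refine Measurable.sub (by fun_prop) ?_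
  exact Measurable.ite (measurableSet_lt (by fun_prop) (by fun_prop)) (by fun_prop) measurable_const

lemma EL_integrable : Integrable EL := by
  refine Integrable.mono' (integrable_inv_one_add_sq.const_mul 6) EL_measurable.aestronglyMeasurable ?_
  exact Eventually.of_forall EL_bound

lemma EL_integral : ∫ s, EL s = - I * Real.pi := by
  have h1 : ∫ s, EL (-s) = ∫ s, EL s := integral_neg_eq_self EL volume
  have h2 : ∀ s, EL s + EL (-s) = (-2 * I) * (((1 + s ^ 2)⁻¹ : ℝ) : ℂ) := by
    intro s
    have hw : (s + I : ℂ) ≠ 0 := by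
      intro h; have := congrArg Complex.im h; simp at this
    have hw2 : (-s + I : ℂ) ≠ 0 := by
      intro h; have := congrArg Complex.im h; simp at this
    have hw3 : (1 + s ^ 2 : ℂ) ≠ 0 := by
      have : (1 + s ^ 2 : ℝ) ≠ 0 := by positivity
      exact_mod_cast this
    have : 1 / (s + I : ℂ) + 1 / (-s + I) = (-2 * I) * (1 + (s : ℂ) ^ 2)⁻¹ := by
      field_simp
      ring_nf
      simp
      try ring_nf
      try simp [pow_succ]
      try ring
    unfold EL
    rw [abs_neg]
    push_cast
    rw [← this]
    split_ifs
    · rw [div_neg]; ring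
    · ring
  have h3 : (∫ s, EL s) + ∫ s, EL (-s) = (-2 * I) * Real.pi := by
    rw [← integral_add EL_integrable EL_integrable.comp_neg]
    simp_rw [h2]
    rw [integral_const_mul, integral_complex_ofReal, integral_univ_inv_one_add_sq]
  rw [h1] at h3
  linear_combination h3 / 2

/-- truncated kernel -/
noncomputable def Kt (h ε t : ℝ) : ℂ :=
  if ε < |t| then ((coth (Real.pi * t / (2 * h)) : ℝ) : ℂ) else 0

lemma Kt_neg (h ε t : ℝ) : Kt h ε (-t) = - Kt h ε t := by
  unfold Kt
  rw [abs_neg, show Real.pi * -t / (2 * h) = -(Real.pi * t / (2 * h)) by ring, coth_neg']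
  split_ifs <;> simp

lemma Kt_measurable (h ε : ℝ) : Measurable (Kt h ε) := by
  unfold Kt
  refine Measurable.ite (measurableSet_lt (by fun_prop) (by fun_prop)) ?_ measurable_const
  exact Complex.measurable_ofReal.comp (coth_measurable.comp (by fun_prop))

lemma coth_scaled_bound {h : ℝ} (hh : 0 < h) (t : ℝ) :
    |coth (Real.pi * t / (2 * h))| ≤ 1 + (2 * h / Real.pi) * (1 / |t|) := by
  refine (abs_coth_le _).trans (le_of_eq ?_)
  have := Real.pi_pos
  rw [abs_div, abs_mul, abs_of_pos this, abs_of_pos (by positivity : 0 < 2 * h)]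
  by_cases ht : t = 0
  · simp [ht]
  have : |t| ≠ 0 := abs_ne_zero.2 ht
  field_simp

lemma Kt_bound {h ε : ℝ} (hh : 0 < h) (hε : 0 < ε) (t : ℝ) :
    ‖Kt h ε t‖ ≤ 1 + (2 * h / Real.pi) * (1 / ε) := by
  have := Real.pi_pos
  unfold Kt
  split_ifs with ht
  · rw [Complex.norm_real, Real.norm_eq_abs]
    refine (coth_scaled_bound hh t).trans ?_
    gcongr
  · rw [norm_zero]; positivity

lemma trunc_eq (h : ℝ) (f : ℝ → ℂ) (x ε : ℝ) :
    truncTilbert h f x ε = (2 * h)⁻¹ • ∫ y, Kt h ε (x - y) * f y := by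
  unfold truncTilbert
  congr 1
  rw [← integral_indicator (measurableSet_lt (by fun_prop) (by fun_prop))]
  congr 1
  ext y
  simp only [Set.indicator, Set.mem_ofPred_eq, Kt]
  split_ifs <;> simp

lemma trunc_sym {h ε : ℝ} (hh : 0 < h) (hε : 0 < ε) (f : ℝ → ℂ) (hf : Integrable f) (x : ℝ) :
    ∫ y, Kt h ε (x - y) * f y = (1 / 2 : ℂ) * ∫ t, Kt h ε t * (f (x - t) - f (x + t)) := by
  have e1 : ∫ y, Kt h ε (x - y) * f y = ∫ t, Kt h ε t * f (x - t) := by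
    rw [← integral_sub_left_eq_self (fun t => Kt h ε t * f (x - t)) volume x]
    simp
  have e2 : ∫ t, Kt h ε t * f (x - t) = - ∫ t, Kt h ε t * f (x + t) := by
    rw [← integral_neg_eq_self (fun t => Kt h ε t * f (x - t)) volume, ← integral_neg]
    congr 1; ext t; rw [Kt_neg]; simp
  have i1 : Integrable (fun t => Kt h ε t * f (x - t)) :=
    (hf.comp_sub_left x).bdd_mul (Kt_measurable h ε).aestronglyMeasurable
      (Eventually.of_forall (Kt_bound hh hε))
  have i2 : Integrable (fun t => Kt h ε t * f (x + t)) :=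
    (hf.comp_add_left x).bdd_mul (Kt_measurable h ε).aestronglyMeasurable
      (Eventually.of_forall (Kt_bound hh hε))
  simp_rw [mul_sub]
  rw [integral_sub i1 i2, e1]
  linear_combination (1 / 2 : ℂ) * e2

lemma schwartz_decay (f : SchwartzMap ℝ ℂ) : ∃ B : ℝ, 0 ≤ B ∧ ∀ y, ‖f y‖ ≤ B * (1 + y ^ 2)⁻¹ := by
  obtain ⟨C0, h0, H0⟩ := f.decay 0 0
  obtain ⟨C2, h2, H2⟩ := f.decay 2 0
  refine ⟨C0 + C2, by positivity, fun y => ?_⟩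
  have a := H0 y
  have b := H2 y
  simp only [norm_iteratedFDeriv_zero, pow_zero, one_mul, Real.norm_eq_abs, sq_abs] at a b
  rw [← div_eq_mul_inv, le_div_iff₀ (by positivity)]
  linarith

lemma schwartz_lip (f : SchwartzMap ℝ ℂ) : ∃ L : ℝ, 0 ≤ L ∧ ∀ y z, ‖f y - f z‖ ≤ L * |y - z| := by
  obtain ⟨C0, h0, H0⟩ := f.decay 0 1
  refine ⟨C0, h0.le, fun y z => ?_⟩
  refine Convex.norm_image_sub_le_of_norm_fderiv_le (𝕜 := ℝ) (s := Set.univ) (f := f)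
    (fun w _ => f.differentiableAt) (fun w _ => ?_) convex_univ (Set.mem_univ z) (Set.mem_univ y)
  simpa [norm_iteratedFDeriv_one] using H0 w

lemma peetre (x t : ℝ) : (1 + (x + t) ^ 2)⁻¹ ≤ 2 * (1 + x ^ 2) * (1 + t ^ 2)⁻¹ := by
  rw [← div_eq_mul_inv, inv_eq_one_div, div_le_div_iff₀ (by positivity) (by positivity)]
  nlinarith [sq_nonneg (x * (x + t)), sq_nonneg (x + (x + t))]

lemma sym_bound {h : ℝ} (hh : 0 < h) (f : SchwartzMap ℝ ℂ) : ∃ K : ℝ, 0 ≤ K ∧ ∀ x t,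
    ‖((coth (Real.pi * t / (2 * h)) : ℝ) : ℂ) * (f (x - t) - f (x + t))‖
      ≤ K * (1 + x ^ 2) * (1 + t ^ 2)⁻¹ := by
  obtain ⟨B, hB, HB⟩ := schwartz_decay f
  obtain ⟨L, hL, HL⟩ := schwartz_lip f
  have hpi := Real.pi_pos
  set b := 2 * h / Real.pi with hb
  have hb0 : 0 < b := by positivity
  refine ⟨4 * B + b * (4 * L + 4 * B), by positivity, fun x t => ?_⟩
  have n1 : ‖f (x - t) - f (x + t)‖ ≤ 4 * B * ((1 + x ^ 2) * (1 + t ^ 2)⁻¹) := by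
    have p1 := peetre x t
    have p2 := peetre x (-t)
    rw [neg_sq, ← sub_eq_add_neg] at p2
    calc _ ≤ ‖f (x - t)‖ + ‖f (x + t)‖ := norm_sub_le _ _
      _ ≤ B * (1 + (x - t) ^ 2)⁻¹ + B * (1 + (x + t) ^ 2)⁻¹ := add_le_add (HB _) (HB _)
      _ ≤ B * (2 * (1 + x ^ 2) * (1 + t ^ 2)⁻¹) + B * (2 * (1 + x ^ 2) * (1 + t ^ 2)⁻¹) := by gcongr
      _ = _ := by ring
  have n2 : ‖f (x - t) - f (x + t)‖ ≤ 2 * L * |t| := by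
    refine (HL _ _).trans (le_of_eq ?_)
    rw [show x - t - (x + t) = -(2 * t) by ring, abs_neg, abs_mul, abs_two]; ring
  set n := ‖f (x - t) - f (x + t)‖
  set q := (1 + x ^ 2) * (1 + t ^ 2)⁻¹ with hq
  have hn : 0 ≤ n := norm_nonneg _
  have hq0 : 0 ≤ q := by positivity
  have n3 : 1 / |t| * n ≤ (4 * L + 4 * B) * q := by
    rcases le_or_gt |t| 1 with ht | ht
    · have : 1 / |t| * n ≤ 2 * L := by
        rcases eq_or_ne t 0 with rfl | h0
        · simp; exact hL
        have : 0 < |t| := abs_pos.2 h0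
        rw [one_div, inv_mul_le_iff₀ this]; linarith
      have t2 : t ^ 2 ≤ 1 := by rw [← sq_abs]; nlinarith [abs_nonneg t]
      have q1 : 1 / 2 ≤ q := by
        rw [hq, ← div_eq_mul_inv, div_le_div_iff₀ (by positivity) (by positivity)]
        nlinarith [sq_nonneg x]
      nlinarith [mul_nonneg hB hq0]
    · have : 1 / |t| ≤ 1 := by rw [div_le_one (by linarith)]; exact ht.le
      nlinarith [mul_nonneg hL hq0]
  rw [norm_mul, Complex.norm_real, Real.norm_eq_abs]
  calc _ ≤ (1 + b * (1 / |t|)) * n := by gcongr; exact coth_scaled_bound hh t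
    _ = n + b * (1 / |t| * n) := by ring
    _ ≤ 4 * B * q + b * ((4 * L + 4 * B) * q) := by gcongr
    _ = _ := by rw [hq]; ring

lemma Kt_mul_bound (h ε t : ℝ) (z : ℂ) :
    ‖Kt h ε t * z‖ ≤ ‖((coth (Real.pi * t / (2 * h)) : ℝ) : ℂ) * z‖ := by
  unfold Kt
  split_ifs
  · rfl
  · rw [zero_mul, norm_zero]; positivity

lemma Kt_tendsto (h t : ℝ) :
    Tendsto (fun ε => Kt h ε t) (nhdsWithin 0 (Set.Ioi 0))
      (nhds ((coth (Real.pi * t / (2 * h)) : ℝ) : ℂ)) := by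
  rcases eq_or_ne t 0 with rfl | h0
  · refine tendsto_const_nhds.congr' ?_
    filter_upwards with ε
    simp [Kt, coth]
  · refine tendsto_const_nhds.congr' ?_
    filter_upwards [Ioo_mem_nhdsGT (abs_pos.2 h0)] with ε hε
    simp [Kt, hε.2]

lemma trunc_bound {h : ℝ} (hh : 0 < h) (f : SchwartzMap ℝ ℂ) : ∃ K : ℝ, 0 ≤ K ∧ ∀ ε, 0 < ε → ∀ x,
    ‖∫ y, Kt h ε (x - y) * f y‖ ≤ K * (1 + x ^ 2) := by
  obtain ⟨K, hK, HK⟩ := sym_bound hh f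
  have hpi := Real.pi_pos
  refine ⟨K * Real.pi / 2, by positivity, fun ε hε x => ?_⟩
  rw [trunc_sym hh hε f f.integrable x, norm_mul]
  have : ‖∫ t, Kt h ε t * (f (x - t) - f (x + t))‖ ≤ ∫ t : ℝ, K * (1 + x ^ 2) * (1 + t ^ 2)⁻¹ := by
    refine norm_integral_le_of_norm_le (integrable_inv_one_add_sq.const_mul _) ?_
    exact Eventually.of_forall (fun t => (Kt_mul_bound _ _ _ _).trans (HK x t))
  rw [integral_const_mul, integral_univ_inv_one_add_sq] at this
  have e : ‖(1 / 2 : ℂ)‖ = 1 / 2 := by norm_num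
  rw [e]
  linarith

lemma sym_meas (h : ℝ) (f : SchwartzMap ℝ ℂ) (x : ℝ) : Measurable
    (fun t : ℝ => ((coth (Real.pi * t / (2 * h)) : ℝ) : ℂ) * (f (x - t) - f (x + t))) := by
  refine Measurable.mul ?_ ?_
  · exact Complex.measurable_ofReal.comp (coth_measurable.comp (by fun_prop))
  · have := f.continuous
    exact Continuous.measurable (by fun_prop)

lemma F_eq {h : ℝ} (hh : 0 < h) (f : SchwartzMap ℝ ℂ) (x : ℝ) (F : ℂ)
    (H : Tendsto (fun ε => truncTilbert h (⇑f) x ε) (nhdsWithin 0 (Set.Ioi 0)) (nhds F)) :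
    F = (2 * h)⁻¹ • ((1 / 2 : ℂ) *
      ∫ t, ((coth (Real.pi * t / (2 * h)) : ℝ) : ℂ) * (f (x - t) - f (x + t))) := by
  obtain ⟨K, hK, HK⟩ := sym_bound hh f
  refine tendsto_nhds_unique H ?_
  have T : Tendsto (fun ε => ∫ t, Kt h ε t * (f (x - t) - f (x + t))) (nhdsWithin 0 (Set.Ioi 0))
      (nhds (∫ t, ((coth (Real.pi * t / (2 * h)) : ℝ) : ℂ) * (f (x - t) - f (x + t)))) := by
    refine tendsto_integral_filter_of_dominated_convergence
      (fun t => K * (1 + x ^ 2) * (1 + t ^ 2)⁻¹) ?_ ?_ (integrable_inv_one_add_sq.const_mul _) ?_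
    · refine Eventually.of_forall (fun ε => Measurable.aestronglyMeasurable ?_)
      have := f.continuous
      exact (Kt_measurable h ε).mul (Continuous.measurable (by fun_prop))
    · exact Eventually.of_forall (fun ε => Eventually.of_forall
        (fun t => (Kt_mul_bound _ _ _ _).trans (HK x t)))
    · exact Eventually.of_forall (fun t => (Kt_tendsto h t).mul_const _)
  refine ((T.const_mul (1 / 2 : ℂ)).const_smul ((2 * h)⁻¹)).congr' ?_
  filter_upwards [self_mem_nhdsWithin] with ε hε
  rw [trunc_eq, trunc_sym hh hε f f.integrable x]

lemma F_cont {h : ℝ} (hh : 0 < h) (f : SchwartzMap ℝ ℂ) (F : ℝ → ℂ)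
    (H : ∀ x, Tendsto (fun ε => truncTilbert h (⇑f) x ε) (nhdsWithin 0 (Set.Ioi 0)) (nhds (F x))) :
    Continuous F := by
  obtain ⟨K, hK, HK⟩ := sym_bound hh f
  have e : F = fun x => (2 * h)⁻¹ • ((1 / 2 : ℂ) *
      ∫ t, ((coth (Real.pi * t / (2 * h)) : ℝ) : ℂ) * (f (x - t) - f (x + t))) :=
    funext (fun x => F_eq hh f x (F x) (H x))
  rw [e]
  suffices hI : Continuous (fun x => ∫ t, ((coth (Real.pi * t / (2 * h)) : ℝ) : ℂ) * (f (x - t) - f (x + t))) from by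
    fun_prop
  rw [continuous_iff_continuousAt]
  intro x0
  refine continuousAt_of_dominated (bound := fun t => K * (1 + (|x0| + 1) ^ 2) * (1 + t ^ 2)⁻¹)
    ?_ ?_ (integrable_inv_one_add_sq.const_mul _) ?_
  · exact Eventually.of_forall (fun x => (sym_meas h f x).aestronglyMeasurable)
  · filter_upwards [Metric.ball_mem_nhds x0 one_pos] with x hx
    refine Eventually.of_forall (fun t => (HK x t).trans ?_)
    rw [Metric.mem_ball, Real.dist_eq] at hx
    have : |x| ≤ |x0| + 1 := by
      have := abs_sub_abs_le_abs_sub x x0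
      linarith
    rw [← sq_abs x]
    gcongr
  · refine Eventually.of_forall (fun t => Continuous.continuousAt ?_)
    have := f.continuous
    fun_prop

/-- the regularised kernel as a function of y -/
noncomputable def pk (h x d y : ℝ) : ℂ := Cc (((Real.pi * (x - y) / (2 * h) : ℝ) : ℂ) + d * I)

lemma pk_measurable (h x d : ℝ) : Measurable (pk h x d) := by
  unfold pk
  exact Cc_measurable.comp (by fun_prop)

lemma pk_bound (h x : ℝ) {d : ℝ} (h0 : 0 < d) (h1 : d < 1) (y : ℝ) : ‖pk h x d y‖ ≤ 1 + 2 / d :=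
  Cc_bound h0 h1 _

lemma plemelj_aux {h : ℝ} (hh : 0 < h) (u : ℝ → ℂ) (hu : Integrable u) (x : ℝ) {d : ℝ}
    (h0 : 0 < d) (h1 : d < 1) :
    (2 * h)⁻¹ • (∫ y, pk h x d y * u y) - truncTilbert h u x (d * (2 * h / Real.pi))
      = (Real.pi : ℂ)⁻¹ * ∫ s, EE d s * u (x - d * (2 * h / Real.pi) * s) := by
  have hpi := Real.pi_pos
  set c := d * (2 * h / Real.pi) with hc
  have hc0 : 0 < c := by positivity
  have i1 : Integrable (fun y => pk h x d y * u y) :=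
    hu.bdd_mul (pk_measurable h x d).aestronglyMeasurable (Eventually.of_forall (pk_bound h x h0 h1))
  have i2 : Integrable (fun y => Kt h c (x - y) * u y) :=
    hu.bdd_mul ((Kt_measurable h c).comp (by fun_prop)).aestronglyMeasurable
      (Eventually.of_forall (fun y => Kt_bound hh hc0 (x - y)))
  let G : ℝ → ℂ := fun t =>
    (Cc (((Real.pi * t / (2 * h) : ℝ) : ℂ) + d * I) - Kt h c t) * u (x - t)
  have e1 : ∫ s, EE d s * u (x - c * s) = (d : ℂ) * ∫ s, G (c * s) := by
    rw [← integral_const_mul]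
    congr 1
    ext s
    have k1 : Real.pi * (c * s) / (2 * h) = d * s := by rw [hc]; field_simp
    have k2 : c < |c * s| ↔ 1 < |s| := by
      rw [abs_mul, abs_of_pos hc0]
      exact lt_mul_iff_one_lt_right hc0
    simp only [G, EE, Kt, k1, k2]
    ring
  have e2 : ∫ s, G (c * s) = (c : ℂ)⁻¹ * ∫ t, G t := by
    rw [Measure.integral_comp_mul_left G c, abs_of_pos (inv_pos.2 hc0), Complex.real_smul]
    push_cast; rfl
  have e3 : ∫ t, G t = ∫ y, G (x - y) := (integral_sub_left_eq_self G volume x).symm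
  have e4 : ∫ y, G (x - y) = (∫ y, pk h x d y * u y) - ∫ y, Kt h c (x - y) * u y := by
    rw [← integral_sub i1 i2]
    congr 1; ext y; simp only [G, pk, sub_sub_cancel]; ring
  rw [e1, e2, e3, e4, trunc_eq, ← smul_sub, Complex.real_smul, ← mul_assoc, ← mul_assoc]
  congr 1
  rw [hc]
  have : (d : ℂ) ≠ 0 := by exact_mod_cast h0.ne'
  have : (h : ℂ) ≠ 0 := by exact_mod_cast hh.ne'
  have : (Real.pi : ℂ) ≠ 0 := by exact_mod_cast hpi.ne'
  push_cast
  field_simp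

lemma plemelj {h : ℝ} (hh : 0 < h) (u : ℝ → ℂ) (hm : Measurable u) (hu : Integrable u) (C : ℝ)
    (hC : ∀ y, ‖u y‖ ≤ C) (x : ℝ) (hc : ContinuousAt u x) (F : ℂ)
    (H : Tendsto (fun ε => truncTilbert h u x ε) (nhdsWithin 0 (Set.Ioi 0)) (nhds F)) :
    Tendsto (fun d => (2 * h)⁻¹ • ∫ y, pk h x d y * u y) (nhdsWithin 0 (Set.Ioi 0))
      (nhds (F - I * u x)) := by
  have hpi := Real.pi_pos
  set b := 2 * h / Real.pi with hb
  have hb0 : 0 < b := by positivity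
  have T1 : Tendsto (fun d : ℝ => d * b) (nhdsWithin 0 (Set.Ioi 0)) (nhdsWithin 0 (Set.Ioi 0)) := by
    refine tendsto_nhdsWithin_iff.2 ⟨?_, ?_⟩
    · have : Continuous (fun d : ℝ => d * b) := by fun_prop
      have := this.tendsto 0
      rw [zero_mul] at this
      exact this.mono_left nhdsWithin_le_nhds
    · filter_upwards [self_mem_nhdsWithin] with d hd
      exact mul_pos hd hb0
  have T2 : Tendsto (fun d : ℝ => ∫ s, EE d s * u (x - d * b * s)) (nhdsWithin 0 (Set.Ioi 0))
      (nhds (∫ s, EL s * u x)) := by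
    refine tendsto_integral_filter_of_dominated_convergence
      (fun s => (6 * (1 + s ^ 2)⁻¹) * C) ?_ ?_ ((integrable_inv_one_add_sq.const_mul _).mul_const _) ?_
    · refine Eventually.of_forall (fun d => Measurable.aestronglyMeasurable ?_)
      exact (EE_measurable d).mul (hm.comp (by fun_prop))
    · filter_upwards [Ioo_mem_nhdsGT (zero_lt_one (α := ℝ))] with d hd
      refine Eventually.of_forall (fun s => ?_)
      rw [norm_mul]
      exact mul_le_mul (EE_bound hd.1 hd.2 s) (hC _) (norm_nonneg _) (by positivity)
    · refine Eventually.of_forall (fun s => (EE_tendsto s).mul (hc.tendsto.comp ?_))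
      have : Continuous (fun d : ℝ => x - d * b * s) := by fun_prop
      have := this.tendsto 0
      simp only [zero_mul, sub_zero] at this
      exact this.mono_left nhdsWithin_le_nhds
  have T3 := (H.comp T1).add (T2.const_mul (Real.pi : ℂ)⁻¹)
  have e : F + (Real.pi : ℂ)⁻¹ * (∫ s, EL s * u x) = F - I * u x := by
    have : (Real.pi : ℂ) ≠ 0 := by exact_mod_cast hpi.ne'
    rw [integral_mul_const, EL_integral]
    field_simp
    ring
  rw [e] at T3
  refine T3.congr' ?_
  filter_upwards [Ioo_mem_nhdsGT (zero_lt_one (α := ℝ))] with d hd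
  have := plemelj_aux hh u hu x hd.1 hd.2
  simp only [Function.comp]
  rw [← this]; ring

lemma fubini_id {h : ℝ} (hh : 0 < h) (f g : ℝ → ℂ) (hf : Integrable f) (hg : Integrable g)
    (x : ℝ) {d ε : ℝ} (h0 : 0 < d) (h1 : d < 1) (hε : 0 < ε) :
    ∫ z : ℝ × ℝ, (if ε < |z.1 - z.2| then pk h x d z.1 * pk h x d z.2 - 1 else 0) * (f z.1 * g z.2)
      = (∫ y, pk h x d y * f y * ∫ w, Kt h ε (y - w) * g w)
        + ∫ w, pk h x d w * g w * ∫ y, Kt h ε (w - y) * f y := by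
  have hpi := Real.pi_pos
  have ifg : Integrable (fun z : ℝ × ℝ => f z.1 * g z.2) (volume.prod volume) := hf.mul_prod hg
  have mK : Measurable (fun z : ℝ × ℝ => Kt h ε (z.1 - z.2)) :=
    (Kt_measurable h ε).comp (by fun_prop)
  have iK : Integrable (fun z : ℝ × ℝ => Kt h ε (z.1 - z.2) * (f z.1 * g z.2)) (volume.prod volume) :=
    ifg.bdd_mul mK.aestronglyMeasurable (Eventually.of_forall (fun z => Kt_bound hh hε _))
  have i1 : Integrable (fun z : ℝ × ℝ => pk h x d z.1 * (Kt h ε (z.1 - z.2) * (f z.1 * g z.2)))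
      (volume.prod volume) :=
    iK.bdd_mul ((pk_measurable h x d).comp measurable_fst).aestronglyMeasurable
      (Eventually.of_forall (fun z => pk_bound h x h0 h1 _))
  have i2 : Integrable (fun z : ℝ × ℝ => pk h x d z.2 * (Kt h ε (z.1 - z.2) * (f z.1 * g z.2)))
      (volume.prod volume) :=
    iK.bdd_mul ((pk_measurable h x d).comp measurable_snd).aestronglyMeasurable
      (Eventually.of_forall (fun z => pk_bound h x h0 h1 _))
  have e0 : ∀ z : ℝ × ℝ,
      (if ε < |z.1 - z.2| then pk h x d z.1 * pk h x d z.2 - 1 else 0) * (f z.1 * g z.2)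
      = pk h x d z.1 * (Kt h ε (z.1 - z.2) * (f z.1 * g z.2))
        - pk h x d z.2 * (Kt h ε (z.1 - z.2) * (f z.1 * g z.2)) := by
    intro z
    unfold Kt
    split_ifs with hz
    · have hne : z.1 - z.2 ≠ 0 := by
        intro h; rw [h] at hz; simp at hz; linarith
      have hs : Complex.sinh ((Real.pi * (z.1 - z.2) / (2 * h) : ℝ) : ℂ) ≠ 0 := by
        rw [← Complex.ofReal_sinh]
        have : Real.sinh (Real.pi * (z.1 - z.2) / (2 * h)) ≠ 0 := by
          rw [Ne, Real.sinh_eq_zero]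
          positivity
        exact_mod_cast this
      have key := Cc_identity (((Real.pi * (x - z.1) / (2 * h) : ℝ) : ℂ) + d * I)
        (((Real.pi * (x - z.2) / (2 * h) : ℝ) : ℂ) + d * I) (sinh_ne h0 h1 _) (sinh_ne h0 h1 _)
      have ee : (((Real.pi * (x - z.2) / (2 * h) : ℝ) : ℂ) + d * I) -
          (((Real.pi * (x - z.1) / (2 * h) : ℝ) : ℂ) + d * I)
          = ((Real.pi * (z.1 - z.2) / (2 * h) : ℝ) : ℂ) := by
        push_cast; ring
      rw [ee] at key
      have key := key hs
      rw [coth_eq_Cc]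
      simp only [pk]
      rw [← key]; ring
    · ring
  simp_rw [e0]
  rw [show (volume : Measure (ℝ × ℝ)) = volume.prod volume from rfl, integral_sub i1 i2,
    integral_prod _ i1, integral_prod_symm _ i2, sub_eq_add_neg, ← integral_neg]
  congr 1
  · congr 1; ext y
    rw [← integral_const_mul]
    congr 1; ext w; ring
  · congr 1; ext w
    rw [← integral_neg, ← integral_const_mul]
    congr 1; ext y
    rw [show w - y = -(y - w) by ring, Kt_neg]; ring

lemma ae_offdiag : ∀ᵐ z : ℝ × ℝ, z.1 ≠ z.2 := by
  rw [ae_iff]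
  have hm : MeasurableSet {z : ℝ × ℝ | ¬ z.1 ≠ z.2} := by
    simp only [ne_eq, not_not]
    exact measurableSet_eq_fun measurable_fst measurable_snd
  rw [show (volume : Measure (ℝ × ℝ)) = volume.prod volume from rfl, Measure.measure_prod_null hm]
  refine Eventually.of_forall (fun x => ?_)
  have : Prod.mk x ⁻¹' {z : ℝ × ℝ | ¬ z.1 ≠ z.2} = {x} := by
    ext y; simp [eq_comm]
  simp only [this]; simp

lemma lim_left (h : ℝ) (f g : ℝ → ℂ) (hf : Integrable f) (hg : Integrable g)
    (x : ℝ) {d : ℝ} (h0 : 0 < d) (h1 : d < 1) :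
    Tendsto (fun ε : ℝ => ∫ z : ℝ × ℝ,
      (if ε < |z.1 - z.2| then pk h x d z.1 * pk h x d z.2 - 1 else 0) * (f z.1 * g z.2))
      (nhdsWithin 0 (Set.Ioi 0))
      (nhds ((∫ y, pk h x d y * f y) * (∫ y, pk h x d y * g y) - (∫ y, f y) * ∫ y, g y)) := by
  have ifg : Integrable (fun z : ℝ × ℝ => f z.1 * g z.2) := hf.mul_prod hg
  have bd := pk_bound h x h0 h1
  have mp := pk_measurable h x d
  have i1 : Integrable (fun y => pk h x d y * f y) :=
    hf.bdd_mul mp.aestronglyMeasurable (Eventually.of_forall bd)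
  have i2 : Integrable (fun y => pk h x d y * g y) :=
    hg.bdd_mul mp.aestronglyMeasurable (Eventually.of_forall bd)
  have i12 : Integrable (fun z : ℝ × ℝ => (pk h x d z.1 * f z.1) * (pk h x d z.2 * g z.2)) :=
    i1.mul_prod i2
  have e : (∫ y, pk h x d y * f y) * (∫ y, pk h x d y * g y) - (∫ y, f y) * ∫ y, g y
      = ∫ z : ℝ × ℝ, (pk h x d z.1 * pk h x d z.2 - 1) * (f z.1 * g z.2) := by
    rw [← integral_prod_mul, ← integral_prod_mul]
    refine (integral_sub i12 ifg).symm.trans ?_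
    congr 1; ext z; ring
  rw [e]
  have mq : Measurable (fun z : ℝ × ℝ => pk h x d z.1 * pk h x d z.2 - 1) :=
    ((mp.comp measurable_fst).mul (mp.comp measurable_snd)).sub measurable_const
  refine tendsto_integral_filter_of_dominated_convergence
    (fun z => ((1 + 2 / d) * (1 + 2 / d) + 1) * ‖f z.1 * g z.2‖) ?_ ?_ (ifg.norm.const_mul _) ?_
  · refine Eventually.of_forall (fun ε => AEStronglyMeasurable.mul ?_ ifg.aestronglyMeasurable)
    refine Measurable.aestronglyMeasurable ?_
    exact Measurable.ite (measurableSet_lt (by fun_prop) (by fun_prop)) mq measurable_const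
  · refine Eventually.of_forall (fun ε => Eventually.of_forall (fun z => ?_))
    rw [norm_mul]
    gcongr
    split_ifs
    · refine (norm_sub_le _ _).trans ?_
      rw [norm_mul, norm_one]
      gcongr
      · exact bd _
      · exact bd _
    · rw [norm_zero]; positivity
  · filter_upwards [ae_offdiag] with z hz
    refine tendsto_const_nhds.congr' ?_
    filter_upwards [Ioo_mem_nhdsGT (abs_pos.2 (sub_ne_zero.2 hz))] with ε hε
    simp [hε.2]

lemma lim_right {h : ℝ} (hh : 0 < h) (f g : SchwartzMap ℝ ℂ) (G : ℝ → ℂ)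
    (H : ∀ x, Tendsto (fun ε => truncTilbert h (⇑g) x ε) (nhdsWithin 0 (Set.Ioi 0)) (nhds (G x)))
    (x : ℝ) {d : ℝ} (h0 : 0 < d) (h1 : d < 1) :
    Tendsto (fun ε : ℝ => ∫ y, pk h x d y * f y * ∫ w, Kt h ε (y - w) * g w)
      (nhdsWithin 0 (Set.Ioi 0))
      (nhds (∫ y, pk h x d y * f y * ((2 * h : ℝ) * G y))) := by
  obtain ⟨K, hK, HK⟩ := trunc_bound hh g
  have mp := pk_measurable h x d
  have mf : Measurable f := f.continuous.measurable
  have mg : Measurable g := g.continuous.measurable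
  have ib : Integrable (fun y : ℝ => ‖f y‖ + ‖y‖ ^ 2 * ‖f y‖) :=
    f.integrable.norm.add (f.integrable_pow_mul volume 2)
  refine tendsto_integral_filter_of_dominated_convergence
    (fun y => (1 + 2 / d) * K * (‖f y‖ + ‖y‖ ^ 2 * ‖f y‖)) ?_ ?_ (ib.const_mul _) ?_
  · refine Eventually.of_forall (fun ε => ((mp.mul mf).aestronglyMeasurable).mul ?_)
    have : Measurable (fun z : ℝ × ℝ => Kt h ε (z.1 - z.2) * g z.2) :=
      ((Kt_measurable h ε).comp (by fun_prop)).mul (mg.comp measurable_snd)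
    exact this.stronglyMeasurable.integral_prod_right'.aestronglyMeasurable
  · filter_upwards [self_mem_nhdsWithin] with ε hε
    refine Eventually.of_forall (fun y => ?_)
    rw [norm_mul, norm_mul]
    calc _ ≤ ((1 + 2 / d) * ‖f y‖) * (K * (1 + y ^ 2)) := by
          gcongr
          · exact pk_bound h x h0 h1 y
          · exact HK ε hε y
      _ = _ := by rw [Real.norm_eq_abs, sq_abs]; ring
  · refine Eventually.of_forall (fun y => Tendsto.const_mul _ ?_)
    refine ((H y).const_mul ((2 * h : ℝ) : ℂ)).congr (fun ε => ?_)
    rw [trunc_eq, Complex.real_smul, ← mul_assoc, ← Complex.ofReal_mul,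
      mul_inv_cancel₀ (by positivity), Complex.ofReal_one, one_mul]

lemma regularised_identity {h : ℝ} (hh : 0 < h) (f g : SchwartzMap ℝ ℂ) (F₁ F₂ : ℝ → ℂ)
    (h₁ : ∀ x, Tendsto (fun ε => truncTilbert h (⇑f) x ε) (nhdsWithin 0 (Set.Ioi 0)) (nhds (F₁ x)))
    (h₂ : ∀ x, Tendsto (fun ε => truncTilbert h (⇑g) x ε) (nhdsWithin 0 (Set.Ioi 0)) (nhds (F₂ x)))
    (hi₁ : Integrable (fun y => f y * F₂ y)) (hi₂ : Integrable (fun y => g y * F₁ y))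
    (x : ℝ) {d : ℝ} (h0 : 0 < d) (h1 : d < 1) :
    (∫ y, pk h x d y * f y) * (∫ y, pk h x d y * g y) - (∫ y, f y) * ∫ y, g y
      = ((2 * h : ℝ) : ℂ) * ∫ y, pk h x d y * (f y * F₂ y + g y * F₁ y) := by
  have T := (lim_right hh f g F₂ h₂ x h0 h1).add (lim_right hh g f F₁ h₁ x h0 h1)
  have T' := lim_left h f g f.integrable g.integrable x h0 h1
  have bd := pk_bound h x h0 h1
  have mp := pk_measurable h x d
  have i1 := hi₁.bdd_mul mp.aestronglyMeasurable (Eventually.of_forall bd)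
  have i2 := hi₂.bdd_mul mp.aestronglyMeasurable (Eventually.of_forall bd)
  have e : ((2 * h : ℝ) : ℂ) * ∫ y, pk h x d y * (f y * F₂ y + g y * F₁ y)
      = (∫ y, pk h x d y * f y * ((2 * h : ℝ) * F₂ y))
        + ∫ y, pk h x d y * g y * ((2 * h : ℝ) * F₁ y) := by
    simp_rw [mul_add]
    rw [integral_add i1 i2, mul_add, ← integral_const_mul, ← integral_const_mul]
    congr 1
    · congr 1; ext y; ring
    · congr 1; ext y; ring
  rw [e]
  refine tendsto_nhds_unique (T'.congr' ?_) T
  filter_upwards [self_mem_nhdsWithin] with ε hε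
  exact fubini_id hh f g f.integrable g.integrable x h0 h1 hε

/-- Cotlar-type identity for the Tilbert transform:
`𝒯_h(f·𝒯_h g + g·𝒯_h f) = 𝒯_h f · 𝒯_h g − f g − M_f M_g`. -/
theorem cotlar_identity (h : ℝ) (hh : 0 < h) (f g : SchwartzMap ℝ ℂ)
    (F₁ F₂ F₃ : ℝ → ℂ)
    (hF₁m : Measurable F₁) (hF₁b : ∃ C : ℝ, ∀ x, ‖F₁ x‖ ≤ C)
    (hF₂m : Measurable F₂) (hF₂b : ∃ C : ℝ, ∀ x, ‖F₂ x‖ ≤ C)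
    (hF₃m : Measurable F₃) (hF₃b : ∃ C : ℝ, ∀ x, ‖F₃ x‖ ≤ C)
    (h₁ : ∀ x : ℝ, Tendsto (fun ε => truncTilbert h (⇑f) x ε)
      (nhdsWithin 0 (Set.Ioi 0)) (nhds (F₁ x)))
    (h₂ : ∀ x : ℝ, Tendsto (fun ε => truncTilbert h (⇑g) x ε)
      (nhdsWithin 0 (Set.Ioi 0)) (nhds (F₂ x)))
    (h₃ : ∀ x : ℝ, Tendsto (fun ε => truncTilbert h (fun y => f y * F₂ y + g y * F₁ y) x ε)
      (nhdsWithin 0 (Set.Ioi 0)) (nhds (F₃ x))) :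
    ∀ x : ℝ, F₃ x = F₁ x * F₂ x - f x * g x -
      ((2 * h)⁻¹ • ∫ y : ℝ, f y) * ((2 * h)⁻¹ • ∫ y : ℝ, g y) := by

  intro x
  obtain ⟨C₁, hC₁⟩ := hF₁b
  obtain ⟨C₂, hC₂⟩ := hF₂b
  have c₁ := F_cont hh f F₁ h₁
  have c₂ := F_cont hh g F₂ h₂
  have cf := f.continuous
  have cg := g.continuous
  obtain ⟨Bf, hBf⟩ : ∃ B : ℝ, ∀ y, ‖f y‖ ≤ B := by
    obtain ⟨C, -, hC⟩ := f.decay 0 0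
    exact ⟨C, fun y => by simpa using hC y⟩
  obtain ⟨Bg, hBg⟩ : ∃ B : ℝ, ∀ y, ‖g y‖ ≤ B := by
    obtain ⟨C, -, hC⟩ := g.decay 0 0
    exact ⟨C, fun y => by simpa using hC y⟩
  have hi₁ : Integrable (fun y => f y * F₂ y) :=
    (f.integrable.bdd_mul (μ := volume) hF₂m.aestronglyMeasurable (Eventually.of_forall hC₂)).congr
      (Eventually.of_forall (fun y => mul_comm _ _))
  have hi₂ : Integrable (fun y => g y * F₁ y) :=
    (g.integrable.bdd_mul (μ := volume) hF₁m.aestronglyMeasurable (Eventually.of_forall hC₁)).congr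
      (Eventually.of_forall (fun y => mul_comm _ _))
  have P₁ := plemelj hh f cf.measurable f.integrable Bf hBf x cf.continuousAt (F₁ x) (h₁ x)
  have P₂ := plemelj hh g cg.measurable g.integrable Bg hBg x cg.continuousAt (F₂ x) (h₂ x)
  have cu : Continuous (fun y => f y * F₂ y + g y * F₁ y) := by fun_prop
  have P₃ := plemelj hh (fun y => f y * F₂ y + g y * F₁ y) cu.measurable (hi₁.add hi₂)
    (Bf * C₂ + Bg * C₁) (fun y => by
      refine (norm_add_le _ _).trans ?_
      rw [norm_mul, norm_mul]
      have a1 := (norm_nonneg _).trans (hBf y)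
      have a2 := (norm_nonneg _).trans (hBg y)
      gcongr
      · exact hBf y
      · exact hC₂ y
      · exact hBg y
      · exact hC₁ y) x cu.continuousAt (F₃ x) (h₃ x)
  have key := tendsto_nhds_unique (P₃.congr' (f₂ := fun d =>
      ((2 * h)⁻¹ • ∫ y, pk h x d y * f y) * ((2 * h)⁻¹ • ∫ y, pk h x d y * g y)
        - ((2 * h)⁻¹ • ∫ y : ℝ, f y) * ((2 * h)⁻¹ • ∫ y : ℝ, g y)) (by
      filter_upwards [Ioo_mem_nhdsGT (zero_lt_one (α := ℝ))] with d hd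
      have r := regularised_identity hh f g F₁ F₂ h₁ h₂ hi₁ hi₂ x hd.1 hd.2
      have hne : ((2 * h : ℝ) : ℂ) ≠ 0 := by
        exact_mod_cast (by positivity : (2 * h : ℝ) ≠ 0)
      simp only [Complex.real_smul, Complex.ofReal_inv]
      have r' : ∀ A B C D E : ℂ, A * B - C * D = ((2 * h : ℝ) : ℂ) * E →
          ((2 * h : ℝ) : ℂ)⁻¹ * E = ((2 * h : ℝ) : ℂ)⁻¹ * A * (((2 * h : ℝ) : ℂ)⁻¹ * B)
            - ((2 * h : ℝ) : ℂ)⁻¹ * C * (((2 * h : ℝ) : ℂ)⁻¹ * D) := by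
        intro A B C D E hE
        generalize ((2 * h : ℝ) : ℂ) = m at hne hE
        field_simp
        rw [hE]
      exact r' _ _ _ _ _ r)) ((P₁.mul P₂).sub_const _)
  linear_combination key + f x * g x * Complex.I_sq
end

section
/- Lax pair commutator identity for the continuum Calogero–Moser equation (deep-water case h = ∞): let β ∈ ℝ and let u, f : ℝ → ℂ be Schwartz functions. Define the Lax operators L f := −i f′ + β·u·P₊(conj(u)·f) and P f := −i f″ + 2β·u·∂_x( P₊(conj(u)·f) ), and set E := −i u″ + 2β·u·P₊( ∂_x(|u|²) ) (so that the CCM equation reads ∂_t u = E). Then L f and P f are Schwartz functions and, pointwise on ℝ, P(L f) − L(P f) = β·E·P₊(conj(u)·f) + β·u·P₊( conj(E)·f ). In particular, if u(t) solves ∂_t u + i∂_x²u = 2β u P₊∂_x(|u|²) then d/dt L_{u(t)} = [P_{u(t)}, L_{u(t)}]. -/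
open MeasureTheory Complex

/-- The positive-frequency (Szegő) projection
`(P₊g)(x) = (2π)^{-1/2} ∫_0^∞ ĝ(ξ) e^{ixξ} dξ`. -/
noncomputable def Pplus (g : ℝ → ℂ) (x : ℝ) : ℂ :=
  (Real.sqrt (2 * Real.pi))⁻¹ • ∫ ξ in Set.Ioi (0 : ℝ), FT g ξ * Complex.exp (Complex.I * x * ξ)

/-- The Lax operator `L f = −i f′ + β·u·P₊(conj(u)·f)` of CCM (deep-water case). -/
noncomputable def Lop (β : ℝ) (u f : ℝ → ℂ) : ℝ → ℂ := fun x =>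
  -Complex.I * deriv f x + (β : ℂ) * u x * Pplus (fun y => (starRingEnd ℂ) (u y) * f y) x

/-- The Peter operator `P f = −i f″ + 2β·u·∂_x(P₊(conj(u)·f))` of CCM. -/
noncomputable def Pop (β : ℝ) (u f : ℝ → ℂ) : ℝ → ℂ := fun x =>
  -Complex.I * deriv (deriv f) x +
    2 * (β : ℂ) * u x * deriv (Pplus (fun y => (starRingEnd ℂ) (u y) * f y)) x

/-- The CCM vector field `E = −i u″ + 2β·u·P₊(∂_x(|u|²))`, so that CCM reads `∂_t u = E`. -/
noncomputable def ccmE (β : ℝ) (u : ℝ → ℂ) : ℝ → ℂ := fun x =>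
  -Complex.I * deriv (deriv u) x +
    2 * (β : ℂ) * u x * Pplus (deriv (fun y => u y * (starRingEnd ℂ) (u y))) x

/-- A function which is (the coercion of) a Schwartz function. -/
def IsS (g : ℝ → ℂ) : Prop := ∃ s : SchwartzMap ℝ ℂ, ∀ x, s x = g x

lemma IsS.of (s : SchwartzMap ℝ ℂ) : IsS s := ⟨s, fun _ => rfl⟩

lemma IsS.add {a b : ℝ → ℂ} (ha : IsS a) (hb : IsS b) : IsS (fun x => a x + b x) := by
  obtain ⟨s, hs⟩ := ha
  obtain ⟨t, ht⟩ := hb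
  exact ⟨s + t, fun x => by simp [hs, ht]⟩

lemma IsS.cmul {a : ℝ → ℂ} (c : ℂ) (ha : IsS a) : IsS (fun x => c * a x) := by
  obtain ⟨s, hs⟩ := ha
  exact ⟨c • s, fun x => by simp [hs]⟩

lemma IsS.eq {a : ℝ → ℂ} (ha : IsS a) : ∃ s : SchwartzMap ℝ ℂ, a = s := by
  obtain ⟨s, hs⟩ := ha
  exact ⟨s, funext fun x => (hs x).symm⟩

lemma IsS.temp {a : ℝ → ℂ} (ha : IsS a) : a.HasTemperateGrowth := by
  obtain ⟨s, rfl⟩ := ha.eq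
  exact s.hasTemperateGrowth

lemma IsS.mul_temp {a b : ℝ → ℂ} (ha : IsS a) (hb : b.HasTemperateGrowth) :
    IsS (fun x => a x * b x) := by
  obtain ⟨s, rfl⟩ := ha.eq
  exact ⟨SchwartzMap.smulLeftCLM ℂ b s, fun x => by simp [hb, mul_comm]⟩

lemma IsS.mul {a b : ℝ → ℂ} (ha : IsS a) (hb : IsS b) : IsS (fun x => a x * b x) :=
  ha.mul_temp hb.temp

lemma IsS.conj {a : ℝ → ℂ} (ha : IsS a) : IsS (fun x => (starRingEnd ℂ) (a x)) := by
  obtain ⟨s, rfl⟩ := ha.eq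
  exact ⟨SchwartzMap.postcompCLM (𝕜 := ℝ) (Complex.conjCLE : ℂ →L[ℝ] ℂ) s, fun x => by simp⟩

lemma temp_conj {a : ℝ → ℂ} (ha : a.HasTemperateGrowth) :
    (fun x => (starRingEnd ℂ) (a x)).HasTemperateGrowth :=
  ((Complex.conjCLE : ℂ →L[ℝ] ℂ).hasTemperateGrowth).comp ha

lemma IsS.deriv {a : ℝ → ℂ} (ha : IsS a) : IsS (deriv a) := by
  obtain ⟨s, rfl⟩ := ha.eq
  exact ⟨SchwartzMap.derivCLM ℝ ℂ s, fun x => by simp⟩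

lemma IsS.hasDerivAt {a : ℝ → ℂ} (ha : IsS a) (x : ℝ) : HasDerivAt a (_root_.deriv a x) x := by
  obtain ⟨s, rfl⟩ := ha.eq
  exact s.differentiable.differentiableAt.hasDerivAt

lemma IsS.integrable {a : ℝ → ℂ} (ha : IsS a) : Integrable a := by
  obtain ⟨s, rfl⟩ := ha.eq
  exact s.integrable

lemma IsS.cont {a : ℝ → ℂ} (ha : IsS a) : Continuous a := by
  obtain ⟨s, rfl⟩ := ha.eq
  exact s.continuous

lemma norm_exp_I (x ξ : ℝ) : ‖Complex.exp (Complex.I * x * ξ)‖ = 1 := by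
  rw [show Complex.I * x * ξ = ((x * ξ : ℝ) : ℂ) * Complex.I by push_cast; ring,
    Complex.norm_exp_ofReal_mul_I]

lemma norm_exp_nI (x ξ : ℝ) : ‖Complex.exp (-(Complex.I * x * ξ))‖ = 1 := by
  rw [show -(Complex.I * x * ξ) = ((-(x * ξ) : ℝ) : ℂ) * Complex.I by push_cast; ring,
    Complex.norm_exp_ofReal_mul_I]

lemma int_mul_exp {μ : Measure ℝ} {a : ℝ → ℂ} (ha : Integrable a μ) (x : ℝ) :
    Integrable (fun ξ : ℝ => a ξ * Complex.exp (Complex.I * x * ξ)) μ := by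
  refine ha.mul_bdd (c := 1) (Continuous.aestronglyMeasurable (by fun_prop)) ?_
  exact Filter.Eventually.of_forall fun ξ => (norm_exp_I x ξ).le

lemma int_mul_nexp {μ : Measure ℝ} {a : ℝ → ℂ} (ha : Integrable a μ) (ξ : ℝ) :
    Integrable (fun x : ℝ => a x * Complex.exp (-(Complex.I * x * ξ))) μ := by
  refine ha.mul_bdd (c := 1) (Continuous.aestronglyMeasurable (by fun_prop)) ?_
  exact Filter.Eventually.of_forall fun x => (norm_exp_nI x ξ).le

lemma FT_eq_fourier (s : SchwartzMap ℝ ℂ) (ξ : ℝ) :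
    FT s ξ = (Real.sqrt (2 * Real.pi))⁻¹ •
      (FourierTransform.fourier s : SchwartzMap ℝ ℂ) (ξ / (2 * Real.pi)) := by
  rw [FT, SchwartzMap.fourier_coe, Real.fourier_real_eq_integral_exp_smul]
  congr 1
  refine integral_congr_ae (Filter.Eventually.of_forall fun x => ?_)
  simp only [smul_eq_mul]
  rw [mul_comm]
  congr 2
  push_cast
  have : (Real.pi : ℂ) ≠ 0 := by exact_mod_cast Real.pi_ne_zero
  field_simp

lemma FT_cont {a : ℝ → ℂ} (ha : IsS a) : Continuous (FT a) := by
  obtain ⟨s, rfl⟩ := ha.eq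
  rw [show FT s = _ from funext (FT_eq_fourier s)]
  exact ((FourierTransform.fourier s : SchwartzMap ℝ ℂ).continuous.comp
    (by fun_prop : Continuous fun ξ : ℝ => ξ / (2 * Real.pi))).const_smul (Real.sqrt (2 * Real.pi))⁻¹

lemma FT_int {a : ℝ → ℂ} (ha : IsS a) : Integrable (FT a) := by
  obtain ⟨s, rfl⟩ := ha.eq
  rw [show FT s = _ from funext (FT_eq_fourier s)]
  exact ((FourierTransform.fourier s : SchwartzMap ℝ ℂ).integrable.comp_div
    (R := 2 * Real.pi) (by positivity)).smul (Real.sqrt (2 * Real.pi))⁻¹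

lemma FT_comb {a b : ℝ → ℂ} (ha : IsS a) (hb : IsS b) (p q : ℂ) (ξ : ℝ) :
    FT (fun y => p * a y + q * b y) ξ = p * FT a ξ + q * FT b ξ := by
  simp only [FT, add_mul, mul_assoc]
  rw [integral_add, integral_const_mul, integral_const_mul]
  · simp only [Complex.real_smul]; ring
  · simpa only [mul_assoc] using (int_mul_nexp ha.integrable ξ).const_mul p
  · simpa only [mul_assoc] using (int_mul_nexp hb.integrable ξ).const_mul q

lemma Pplus_comb {a b : ℝ → ℂ} (ha : IsS a) (hb : IsS b) (p q : ℂ) (x : ℝ) :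
    Pplus (fun y => p * a y + q * b y) x = p * Pplus a x + q * Pplus b x := by
  simp only [Pplus, FT_comb ha hb, add_mul, mul_assoc]
  rw [integral_add, integral_const_mul, integral_const_mul]
  · simp only [Complex.real_smul]; ring
  · simpa only [mul_assoc] using (int_mul_exp (FT_int ha).integrableOn x).const_mul p
  · simpa only [mul_assoc] using (int_mul_exp (FT_int hb).integrableOn x).const_mul q

lemma FT_deriv {a : ℝ → ℂ} (ha : IsS a) (ξ : ℝ) :
    FT (deriv a) ξ = Complex.I * ξ * FT a ξ := by
  have hd : ∀ x : ℝ, HasDerivAt (fun x : ℝ => Complex.exp (-(Complex.I * x * ξ)))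
      (-(Complex.I * ξ) * Complex.exp (-(Complex.I * x * ξ))) x := by
    intro x
    have h1 : HasDerivAt (fun x : ℝ => -(Complex.I * x * ξ)) (-(Complex.I * ξ)) x := by
      have := (((hasDerivAt_id x).ofReal_comp.const_mul Complex.I).mul_const (ξ : ℂ)).neg
      simpa [Pi.neg_def] using this
    simpa [mul_comm] using h1.cexp
  have key := integral_mul_deriv_eq_deriv_mul_of_integrable
    (u := fun x : ℝ => Complex.exp (-(Complex.I * x * ξ))) (v := a)
    (u' := fun x : ℝ => -(Complex.I * ξ) * Complex.exp (-(Complex.I * x * ξ)))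
    (v' := deriv a) (fun x _ => hd x) (fun x _ => ha.hasDerivAt x)
    (by simpa [mul_comm, Pi.mul_def] using int_mul_nexp ha.deriv.integrable ξ)
    (by
      have := (int_mul_nexp ha.integrable ξ).const_mul (-(Complex.I * ξ))
      refine this.congr (Filter.Eventually.of_forall fun x => ?_)
      simp only [Pi.mul_apply]; ring)
    (by simpa [mul_comm, Pi.mul_def] using int_mul_nexp ha.integrable ξ)
  have e1 : ∫ x : ℝ, deriv a x * Complex.exp (-(Complex.I * x * ξ)) =
      Complex.I * ξ * ∫ x : ℝ, a x * Complex.exp (-(Complex.I * x * ξ)) := by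
    rw [← integral_const_mul]
    calc _ = ∫ x : ℝ, Complex.exp (-(Complex.I * x * ξ)) * deriv a x := by
          simp only [mul_comm]
      _ = _ := by
          rw [key, ← integral_neg]
          congr 1 with x
          ring
  simp only [FT, e1, Complex.real_smul]
  ring

lemma Pplus_bdd {a : ℝ → ℂ} : ∃ C, ∀ x, ‖Pplus a x‖ ≤ C := by
  refine ⟨‖(Real.sqrt (2 * Real.pi))⁻¹‖ * ∫ ξ in Set.Ioi (0 : ℝ), ‖FT a ξ‖, fun x => ?_⟩
  rw [Pplus, norm_smul]
  refine mul_le_mul_of_nonneg_left ((norm_integral_le_integral_norm _).trans (le_of_eq ?_))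
    (norm_nonneg _)
  simp only [norm_mul, norm_exp_I, mul_one]

lemma Pplus_hasDerivAt {a : ℝ → ℂ} (ha : IsS a) (x : ℝ) :
    HasDerivAt (Pplus a) (Pplus (deriv a) x) x := by
  have h := hasDerivAt_integral_of_dominated_loc_of_deriv_le
    (μ := volume.restrict (Set.Ioi (0 : ℝ))) (s := Set.univ) (x₀ := x)
    (F := fun (x : ℝ) (ξ : ℝ) => FT a ξ * Complex.exp (Complex.I * x * ξ))
    (F' := fun (x : ℝ) (ξ : ℝ) => FT (deriv a) ξ * Complex.exp (Complex.I * x * ξ))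
    (bound := fun ξ => ‖FT (deriv a) ξ‖) Filter.univ_mem
    (Filter.Eventually.of_forall fun y =>
      (int_mul_exp (FT_int ha).integrableOn y).aestronglyMeasurable)
    (int_mul_exp (FT_int ha).integrableOn x)
    (int_mul_exp (FT_int ha.deriv).integrableOn x).aestronglyMeasurable
    (Filter.Eventually.of_forall fun ξ y _ => by simp [norm_exp_I])
    (FT_int ha.deriv).norm.integrableOn
    (Filter.Eventually.of_forall fun ξ y _ => by
      have h1 : HasDerivAt (fun x : ℝ => Complex.I * x * ξ) (Complex.I * ξ) y := by
        have := ((hasDerivAt_id y).ofReal_comp.const_mul Complex.I).mul_const (ξ : ℂ)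
        simpa using this
      have := h1.cexp.const_mul (FT a ξ)
      rw [FT_deriv ha]
      convert! this using 1
      ring)
  exact h.2.const_smul (Real.sqrt (2 * Real.pi))⁻¹

lemma Pplus_deriv {a : ℝ → ℂ} (ha : IsS a) : deriv (Pplus a) = Pplus (deriv a) :=
  funext fun x => (Pplus_hasDerivAt ha x).deriv

lemma Pplus_iter (n : ℕ) : ∀ {a : ℝ → ℂ}, IsS a →
    ∃ b, IsS b ∧ iteratedDeriv n (Pplus a) = Pplus b := by
  induction n with
  | zero => intro a ha; exact ⟨a, ha, by simp⟩
  | succ n ih =>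
    intro a ha
    obtain ⟨b, hb, h⟩ := ih ha.deriv
    exact ⟨b, hb, by rw [iteratedDeriv_succ', Pplus_deriv ha, h]⟩

lemma Pplus_temp {a : ℝ → ℂ} (ha : IsS a) : (Pplus a).HasTemperateGrowth := by
  refine ⟨contDiff_of_differentiable_iteratedDeriv fun m _ => ?_, fun n => ?_⟩
  · obtain ⟨b, hb, h⟩ := Pplus_iter m ha
    rw [h]
    exact fun x => (Pplus_hasDerivAt hb x).differentiableAt
  · obtain ⟨b, hb, h⟩ := Pplus_iter n ha
    obtain ⟨C, hC⟩ := Pplus_bdd (a := b)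
    refine ⟨0, C, fun x => ?_⟩
    rw [norm_iteratedFDeriv_eq_norm_iteratedDeriv, h]
    simpa using hC x

/-- Fourier transform of a product with a superposition of plane waves. -/
lemma FT_mul_wave {g h : ℝ → ℂ} (hg : IsS g) (hh : Integrable h) (σ ξ : ℝ) :
    FT (fun y => g y * ∫ η in Set.Ioi (0 : ℝ), h η * Complex.exp (Complex.I * y * (σ * η : ℝ))) ξ =
      ∫ η in Set.Ioi (0 : ℝ), h η * FT g (ξ - σ * η) := by
  have hint : Integrable (Function.uncurry fun (y η : ℝ) =>
      (g y * h η) * (Complex.exp (Complex.I * y * (σ * η : ℝ)) * Complex.exp (-(Complex.I * y * ξ))))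
      (volume.prod (volume.restrict (Set.Ioi (0 : ℝ)))) := by
    refine (hg.integrable.mul_prod hh.integrableOn).mul_bdd (c := 1)
      (Continuous.aestronglyMeasurable (by fun_prop)) ?_
    exact Filter.Eventually.of_forall fun p => by
      rw [norm_mul, norm_exp_I, norm_exp_nI, one_mul]
  have hsw := integral_integral_swap hint
  simp only [FT, Complex.real_smul]
  rw [show (∫ x : ℝ, (g x * ∫ η in Set.Ioi (0 : ℝ), h η * Complex.exp (Complex.I * x * (σ * η : ℝ))) *
      Complex.exp (-(Complex.I * x * ξ))) = ∫ x : ℝ, ∫ η in Set.Ioi (0 : ℝ), (g x * h η) *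
        (Complex.exp (Complex.I * x * (σ * η : ℝ)) * Complex.exp (-(Complex.I * x * ξ))) from ?_, hsw,
    ← integral_const_mul]
  · congr 1 with η
    rw [mul_left_comm]
    congr 1
    rw [← integral_const_mul]
    congr 1 with y
    rw [← Complex.exp_add]
    rw [show Complex.I * y * (σ * η : ℝ) + -(Complex.I * y * ξ) =
      -(Complex.I * y * ((ξ - σ * η : ℝ) : ℂ)) by push_cast; ring]
    ring
  · congr 1 with x
    rw [← integral_const_mul, ← integral_mul_const]
    congr 1 with η
    ring

lemma conj_FT_real {g : ℝ → ℂ} (hr : ∀ x, (starRingEnd ℂ) (g x) = g x) (η : ℝ) :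
    (starRingEnd ℂ) (FT g η) = FT g (-η) := by
  simp only [FT, Complex.real_smul, map_mul, Complex.conj_ofReal]
  congr 1
  rw [← integral_conj]
  congr 1 with y
  simp [hr, ← Complex.exp_conj]

lemma FT_int_left {g : ℝ → ℂ} (hg : IsS g) {w : ℝ → ℂ} (hw : IsS w) (ξ : ℝ) :
    Integrable (fun η => FT w η * FT g (ξ - η)) := by
  obtain ⟨s, rfl⟩ := hg.eq
  set C := (FourierTransform.fourier s : SchwartzMap ℝ ℂ).toBoundedContinuousFunction with hC
  refine (FT_int hw).mul_bdd (c := ‖(Real.sqrt (2 * Real.pi))⁻¹‖ * ‖C‖)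
    ((FT_cont hg).comp (by fun_prop)).aestronglyMeasurable ?_
  refine Filter.Eventually.of_forall fun η => ?_
  rw [FT_eq_fourier, norm_smul]
  exact mul_le_mul_of_nonneg_left (C.norm_coe_le_norm _) (norm_nonneg _)

lemma Pplus_prod {g w : ℝ → ℂ} (hg : IsS g) (hw : IsS w)
    (hr : ∀ x, (starRingEnd ℂ) (g x) = g x) (x : ℝ) :
    Pplus (fun y => g y * Pplus w y) x =
      Pplus g x * Pplus w x + Pplus (fun y => w y * (starRingEnd ℂ) (Pplus g y)) x := by
  set c : ℂ := (((Real.sqrt (2 * Real.pi))⁻¹ : ℝ) : ℂ) with hc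
  have h1 : ∀ ξ, FT (fun y => g y * Pplus w y) ξ =
      c * ∫ η in Set.Ioi (0 : ℝ), FT w η * FT g (ξ - η) := by
    intro ξ
    have := FT_mul_wave hg ((FT_int hw).const_mul c) 1 ξ
    simp only [one_mul, mul_assoc c, integral_const_mul] at this
    rw [← this]
    rfl
  have h2 : ∀ ξ, FT (fun y => w y * (starRingEnd ℂ) (Pplus g y)) ξ =
      c * ∫ η in Set.Ioi ξ, FT w η * FT g (ξ - η) := by
    intro ξ
    have := FT_mul_wave hw (((FT_int hg).comp_neg).const_mul c) (-1) ξ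
    simp only [mul_assoc c, integral_const_mul] at this
    have ht := (measurePreserving_add_left volume ξ).setIntegral_preimage_emb
      (measurableEmbedding_addLeft ξ) (fun η => FT w η * FT g (ξ - η)) (Set.Ioi ξ)
    rw [← ht]
    have e : ((fun x => ξ + x) ⁻¹' Set.Ioi ξ) = Set.Ioi (0 : ℝ) := by
      ext z; simp
    rw [e]
    calc _ = _ := ?_
      _ = _ := this
      _ = _ := ?_
    · congr 1 with y
      rw [Pplus, Complex.real_smul, map_mul, Complex.conj_ofReal, ← integral_conj]
      congr 3 with η
      rw [map_mul, conj_FT_real hr, ← Complex.exp_conj]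
      simp
    · congr 2 with η
      rw [show ξ - -1 * η = ξ + η by ring, show ξ - (ξ + η) = -η by ring, mul_comm]
  have h3 : ∀ ξ ∈ Set.Ioi (0 : ℝ), FT (fun y => g y * Pplus w y) ξ * Complex.exp (Complex.I * x * ξ)
      - FT (fun y => w y * (starRingEnd ℂ) (Pplus g y)) ξ * Complex.exp (Complex.I * x * ξ) =
      c * ∫ η in (0 : ℝ)..ξ, (ContinuousLinearMap.mul ℝ ℂ)
        (FT w η * Complex.exp (Complex.I * x * η))
        ((fun ζ : ℝ => FT g ζ * Complex.exp (Complex.I * x * ζ)) (ξ - η)) := by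
    intro ξ hξ
    have hI := FT_int_left hg hw ξ
    rw [h1, h2, intervalIntegral.integral_of_le (le_of_lt hξ)]
    have hu : (Set.Ioi (0 : ℝ)) = Set.Ioc 0 ξ ∪ Set.Ioi ξ :=
      (Set.Ioc_union_Ioi_eq_Ioi (le_of_lt hξ)).symm
    rw [hu, setIntegral_union (Set.Ioc_disjoint_Ioi le_rfl) measurableSet_Ioi
      hI.integrableOn hI.integrableOn]
    have : ∀ η : ℝ, (ContinuousLinearMap.mul ℝ ℂ)
        (FT w η * Complex.exp (Complex.I * x * η))
        ((fun ζ : ℝ => FT g ζ * Complex.exp (Complex.I * x * ζ)) (ξ - η)) =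
        FT w η * FT g (ξ - η) * Complex.exp (Complex.I * x * ξ) := by
      intro η
      simp only [ContinuousLinearMap.mul_apply']
      rw [show Complex.I * x * ξ = Complex.I * x * η + Complex.I * x * ((ξ - η : ℝ) : ℂ) by
        push_cast; ring, Complex.exp_add]
      ring
    simp only [this]
    rw [integral_mul_const]
    ring
  have hpc := integral_posConvolution (μ := volume) (ν := volume)
    (int_mul_exp (FT_int hw).integrableOn x) (int_mul_exp (FT_int hg).integrableOn x)
    (ContinuousLinearMap.mul ℝ ℂ)
  have hS1 : IsS (fun y => g y * Pplus w y) := hg.mul_temp (Pplus_temp hw)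
  have hS2 : IsS (fun y => w y * (starRingEnd ℂ) (Pplus g y)) :=
    hw.mul_temp (temp_conj (Pplus_temp hg))
  have h4 := setIntegral_congr_fun (μ := volume) measurableSet_Ioi h3
  rw [integral_sub (int_mul_exp (FT_int hS1).integrableOn x)
    (int_mul_exp (FT_int hS2).integrableOn x), integral_const_mul, hpc,
    ContinuousLinearMap.mul_apply', sub_eq_iff_eq_add] at h4
  rw [Pplus, h4]
  simp only [Pplus, Complex.real_smul]
  ring


/-- Lax pair commutator identity for the continuum Calogero–Moser equation
(deep-water case): `L f` and `P f` are Schwartz and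
`P(L f) − L(P f) = β·E·P₊(conj(u)·f) + β·u·P₊(conj(E)·f)` pointwise. -/
theorem lax_pair_commutator (β : ℝ) (u f : SchwartzMap ℝ ℂ) :
    (∃ Lf : SchwartzMap ℝ ℂ, ∀ x : ℝ, Lf x = Lop β (⇑u) (⇑f) x) ∧
    (∃ Pf : SchwartzMap ℝ ℂ, ∀ x : ℝ, Pf x = Pop β (⇑u) (⇑f) x) ∧
    ∀ x : ℝ,
      Pop β (⇑u) (Lop β (⇑u) (⇑f)) x - Lop β (⇑u) (Pop β (⇑u) (⇑f)) x =
        (β : ℂ) * ccmE β (⇑u) x * Pplus (fun y => (starRingEnd ℂ) (u y) * f y) x +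
          (β : ℂ) * u x * Pplus (fun y => (starRingEnd ℂ) (ccmE β (⇑u) y) * f y) x := by
  have hu : IsS u := .of u
  have hf : IsS f := .of f
  set v : ℝ → ℂ := fun y => (starRingEnd ℂ) (u y) with hvdef
  have hv : IsS v := hu.conj
  set w : ℝ → ℂ := fun y => v y * f y with hwdef
  have hw : IsS w := hv.mul hf
  set q : ℝ → ℂ := fun y => u y * v y with hqdef
  have hq : IsS q := hu.mul hv
  have hdv : ∀ y, HasDerivAt v ((starRingEnd ℂ) (deriv u y)) y := fun y =>
    (Complex.conjCLE : ℂ →L[ℝ] ℂ).hasFDerivAt.comp_hasDerivAt y (hu.hasDerivAt y)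
  have hdv' : deriv v = fun y => (starRingEnd ℂ) (deriv u y) := funext fun y => (hdv y).deriv
  have hddv : deriv (deriv v) = fun y => (starRingEnd ℂ) (deriv (deriv u) y) := by
    rw [hdv']
    funext y
    exact ((Complex.conjCLE : ℂ →L[ℝ] ℂ).hasFDerivAt.comp_hasDerivAt y
      (hu.deriv.hasDerivAt y)).deriv
  have hgr : ∀ y, (starRingEnd ℂ) (deriv q y) = deriv q y := by
    intro y
    have h1 : HasDerivAt q (deriv u y * v y + u y * (starRingEnd ℂ) (deriv u y)) y :=
      (hu.hasDerivAt y).mul (hdv y)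
    rw [h1.deriv]
    simp [hvdef]
    ring
  -- derivatives of `w`
  have hw1 : deriv w = fun y => deriv v y * f y + v y * deriv f y :=
    funext fun y => ((hv.hasDerivAt y).mul (hf.hasDerivAt y)).deriv
  have hw2 : deriv (deriv w) = fun y => 1 * (deriv (deriv v) y * f y) +
      1 * (2 * (deriv v y * deriv f y) + 1 * (v y * deriv (deriv f) y)) := by
    rw [hw1]
    funext y
    refine (((hv.deriv.hasDerivAt y).mul (hf.hasDerivAt y)).add
      ((hv.hasDerivAt y).mul (hf.deriv.hasDerivAt y))).deriv.trans ?_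
    ring
  have hW := Pplus_hasDerivAt hw
  have hW' := Pplus_hasDerivAt hw.deriv
  have tW := Pplus_temp hw
  have tW' := Pplus_temp hw.deriv
  have hL : Lop β u f = fun x => -Complex.I * deriv f x + (β : ℂ) * (u x * Pplus w x) := by
    funext x; simp only [Lop]; ring
  have hP : Pop β u f = fun x => -Complex.I * deriv (deriv f) x +
      (2 * β : ℂ) * (u x * Pplus (deriv w) x) := by
    funext x; simp only [Pop]; rw [Pplus_deriv hw]; ring
  have sL : IsS (Lop β u f) := by
    rw [hL]; exact (hf.deriv.cmul _).add ((hu.mul_temp tW).cmul _)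
  have sP : IsS (Pop β u f) := by
    rw [hP]; exact (hf.deriv.deriv.cmul _).add ((hu.mul_temp tW').cmul _)
  refine ⟨sL, sP, fun x => ?_⟩
  -- derivatives of `L f` and `P f`
  have hL1 : deriv (Lop β u f) = fun x => -Complex.I * deriv (deriv f) x +
      (β : ℂ) * (deriv u x * Pplus w x + u x * Pplus (deriv w) x) := by
    rw [hL]
    funext y
    exact (((hf.deriv.hasDerivAt y).const_mul _).add
      (((hu.hasDerivAt y).mul (hW y)).const_mul _)).deriv
  have hL2 : deriv (deriv (Lop β u f)) x = -Complex.I * deriv (deriv (deriv f)) x +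
      (β : ℂ) * ((deriv (deriv u) x * Pplus w x + deriv u x * Pplus (deriv w) x) +
        (deriv u x * Pplus (deriv w) x + u x * Pplus (deriv (deriv w)) x)) := by
    rw [hL1]
    exact (((hf.deriv.deriv.hasDerivAt x).const_mul _).add
      ((((hu.deriv.hasDerivAt x).mul (hW x)).add
        ((hu.hasDerivAt x).mul (hW' x))).const_mul _)).deriv
  have hP1 : deriv (Pop β u f) x = -Complex.I * deriv (deriv (deriv f)) x +
      (2 * β : ℂ) * (deriv u x * Pplus (deriv w) x + u x * Pplus (deriv (deriv w)) x) := by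
    rw [hP]
    exact (((hf.deriv.deriv.hasDerivAt x).const_mul _).add
      (((hu.hasDerivAt x).mul (hW' x)).const_mul _)).deriv
  -- the building blocks
  have sa : IsS (fun y => v y * deriv (deriv f) y) := hv.mul hf.deriv.deriv
  have sb : IsS (fun y => deriv v y * deriv f y) := hv.deriv.mul hf.deriv
  have sc : IsS (fun y => deriv (deriv v) y * f y) := hv.deriv.deriv.mul hf
  have sd : IsS (fun y => deriv q y * Pplus w y) := hq.deriv.mul_temp tW
  have se : IsS (fun y => q y * Pplus (deriv w) y) := hq.mul_temp tW'
  have sk : IsS (fun y => w y * (starRingEnd ℂ) (Pplus (deriv q) y)) :=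
    hw.mul_temp (temp_conj (Pplus_temp hq.deriv))
  have e1 : deriv (Pplus fun y => v y * Lop β u f y) x =
      -Complex.I * (Pplus (fun y => deriv v y * deriv f y) x +
        Pplus (fun y => v y * deriv (deriv f) y) x) +
      β * (Pplus (fun y => deriv q y * Pplus w y) x +
        Pplus (fun y => q y * Pplus (deriv w) y) x) := by
    rw [Pplus_deriv (hv.mul sL)]
    have : deriv (fun y => v y * Lop β u f y) = fun y =>
        (-Complex.I) * (1 * (deriv v y * deriv f y) + 1 * (v y * deriv (deriv f) y)) +
        (β : ℂ) * (1 * (deriv q y * Pplus w y) + 1 * (q y * Pplus (deriv w) y)) := by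
      funext y
      refine ((hv.hasDerivAt y).mul (sL.hasDerivAt y)).deriv.trans ?_
      have hq1 : deriv q y = deriv u y * v y + u y * deriv v y :=
        ((hu.hasDerivAt y).mul (hv.hasDerivAt y)).deriv
      rw [hL1, hL, hq1]
      simp only [hqdef]
      ring
    rw [this, Pplus_comb ((sb.cmul 1).add (sa.cmul 1)) ((sd.cmul 1).add (se.cmul 1)),
      Pplus_comb sb sa, Pplus_comb sd se]
    ring
  have e2 : Pplus (fun y => v y * Pop β u f y) x =
      -Complex.I * Pplus (fun y => v y * deriv (deriv f) y) x +
      (2 * β : ℂ) * Pplus (fun y => q y * Pplus (deriv w) y) x := by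
    rw [← Pplus_comb sa se]
    congr 1
    funext y
    rw [hP]
    simp only [hqdef]
    ring
  have e3 : Pplus (deriv (deriv w)) x = Pplus (fun y => deriv (deriv v) y * f y) x +
      (2 * Pplus (fun y => deriv v y * deriv f y) x +
        Pplus (fun y => v y * deriv (deriv f) y) x) := by
    rw [hw2, Pplus_comb sc ((sb.cmul 2).add (sa.cmul 1)), Pplus_comb sb sa]
    ring
  have e4 : Pplus (fun y => (starRingEnd ℂ) (ccmE β u y) * f y) x =
      Complex.I * Pplus (fun y => deriv (deriv v) y * f y) x +
      (2 * β : ℂ) * Pplus (fun y => w y * (starRingEnd ℂ) (Pplus (deriv q) y)) x := by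
    rw [← Pplus_comb sc sk]
    congr 1
    funext y
    rw [hddv]
    simp only [ccmE, hwdef, hvdef, hqdef, map_add, map_mul, map_neg, Complex.conj_I,
      Complex.conj_ofReal, map_ofNat]
    ring
  have e5 := Pplus_prod hq.deriv hw hgr x
  have e6 : ccmE β u x = -Complex.I * deriv (deriv u) x +
      2 * (β : ℂ) * u x * Pplus (deriv q) x := rfl
  have e7 : Pop β u (Lop β u f) x = -Complex.I * deriv (deriv (Lop β u f)) x +
      2 * (β : ℂ) * u x * deriv (Pplus fun y => v y * Lop β u f y) x := rfl
  have e8 : Lop β u (Pop β u f) x = -Complex.I * deriv (Pop β u f) x +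
      (β : ℂ) * u x * Pplus (fun y => v y * Pop β u f y) x := rfl
  rw [e7, e8, hL2, hP1, e1, e2, e3, e4, e5, e6]
  ring
end
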